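/- arXiv:math/0303386 — 3 statements merged into one kernel-verified Lean document; each statement's English description precedes it below -/
import Mathlib

section
/- Let 0 < ε < (2k−3)/(k(2k−1)(4k−3)). Suppose w is a cyclically reduced word of length n such that: (a) for every letter x ∈ Σ, w_x/n ∈ (1/(2k) − ε/2, 1/(2k) + ε/2); and (b) for every pair x, y ∈ Σ with y ≠ x^{-1}, the Whitehead graph edge label satisfies ŵ_{xy}/n ∈ (1/(k(2k−1)) − ε, 1/(k(2k−1)) + ε). Then for every non-inner Whitehead automorphism τ of F_k of the second kind, ||τ(w)|| > ||w|| = |w|; that is, w is strictly minimal. -/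
/-! Common definitions: free group `FG k = F(a_1,…,a_k)`, reduced and cyclically
reduced words, Whitehead automorphisms, strict minimality, counting functions and
exponential genericity, following Kapovich–Schupp–Shpilrain. -/

/-- The free group of rank `k` on the basis `a_1,…,a_k`. -/
abbrev FG (k : ℕ) := FreeGroup (Fin k)

/-- The alphabet `Σ = {a_1,…,a_k}^{±1}`: a letter is a basis index together with a sign. -/
abbrev Letter (k : ℕ) := Fin k × Bool

/-- The inverse of a letter. -/
def linv {k : ℕ} (x : Letter k) : Letter k := (x.1, !x.2)

/-- The length `|g|` of the reduced word representing `g`. -/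
def wordLength {k : ℕ} (g : FG k) : ℕ := (FreeGroup.toWord g).length

/-- A word is (freely) reduced if it equals its free reduction. -/
def ReducedWord {k : ℕ} (w : List (Letter k)) : Prop := FreeGroup.reduce w = w

/-- A word is cyclically reduced if all of its cyclic permutations are reduced;
equivalently, `w ++ w` is reduced. -/
def CyclicallyReducedWord {k : ℕ} (w : List (Letter k)) : Prop :=
  FreeGroup.reduce (w ++ w) = w ++ w

/-- An element of `FG k` is cyclically reduced if its reduced word is. -/
def IsCyclicallyReduced {k : ℕ} (g : FG k) : Prop :=
  CyclicallyReducedWord (FreeGroup.toWord g)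

/-- `C`, the set of all cyclically reduced elements of `FG k`. -/
def Cset (k : ℕ) : Set (FG k) := {g | IsCyclicallyReduced g}

/-- The cyclic length `‖g‖`: the length of the cyclically reduced form of `g`
(the unique cyclically reduced `u` with `g = x u x⁻¹`). -/
noncomputable def cyclicLength {k : ℕ} (g : FG k) : ℕ :=
  sInf {n | ∃ x u : FG k, IsCyclicallyReduced u ∧ g = x * u * x⁻¹ ∧ wordLength u = n}

/-- The set `Σ = {a_1,…,a_k}^{±1}` inside the free group. -/
def letterSet (k : ℕ) : Set (FG k) :=
  {g | ∃ i : Fin k, g = FreeGroup.of i ∨ g = (FreeGroup.of i)⁻¹}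

/-- A Whitehead automorphism of the first kind: a relabeling automorphism,
i.e. one whose restriction to `Σ` is a permutation of `Σ`. -/
def IsRelabeling {k : ℕ} (τ : MulAut (FG k)) : Prop :=
  (⇑τ) '' letterSet k = letterSet k

/-- A Whitehead automorphism of the second kind, with multiplier `a ∈ Σ`:
`τ a = a` and `τ x ∈ {x, xa, a⁻¹x, a⁻¹xa}` for all `x ∈ Σ`. -/
def IsWhitehead2 {k : ℕ} (τ : MulAut (FG k)) : Prop :=
  ∃ a ∈ letterSet k, τ a = a ∧
    ∀ x ∈ letterSet k, τ x = x ∨ τ x = x * a ∨ τ x = a⁻¹ * x ∨ τ x = a⁻¹ * x * a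

/-- An automorphism is inner if it is conjugation by some element. -/
def IsInner {k : ℕ} (α : MulAut (FG k)) : Prop := ∃ g : FG k, α = MulAut.conj g

/-- `SM`: the set of strictly minimal cyclically reduced elements, those `w` with
`‖τ w‖ > |w|` for every non-inner Whitehead automorphism `τ` of the second kind. -/
def SM (k : ℕ) : Set (FG k) :=
  {w | IsCyclicallyReduced w ∧
    ∀ τ : MulAut (FG k), IsWhitehead2 τ → ¬ IsInner τ → wordLength w < cyclicLength (τ w)}

/-- `SM'`: elements whose cyclically reduced form lies in `SM`. -/
def SM' (k : ℕ) : Set (FG k) := {g | ∃ x u : FG k, u ∈ SM k ∧ g = x * u * x⁻¹}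

/-- `γ(n,S)`: the number of elements of `S` of length `n`. -/
noncomputable def gammaC {k : ℕ} (S : Set (FG k)) (n : ℕ) : ℕ :=
  {g ∈ S | wordLength g = n}.ncard

/-- `ρ(n,S)`: the number of elements of `S` of length at most `n`. -/
noncomputable def rhoC {k : ℕ} (S : Set (FG k)) (n : ℕ) : ℕ :=
  {g ∈ S | wordLength g ≤ n}.ncard

/-- `B ⊆ S` is exponentially generic in `S` if `ρ(n,B)/ρ(n,S) → 1`
exponentially fast. -/
def ExpGenericIn {k : ℕ} (B S : Set (FG k)) : Prop :=
  B ⊆ S ∧ ∃ K : ℝ, 0 < K ∧ ∃ σ : ℝ, 0 < σ ∧ σ < 1 ∧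
    ∀ n : ℕ, |1 - (rhoC B n : ℝ) / (rhoC S n : ℝ)| ≤ K * σ ^ n

/-- `B` is exponentially negligible in `S` if `S \ B` is exponentially generic in `S`. -/
def ExpNegligibleIn {k : ℕ} (B S : Set (FG k)) : Prop := ExpGenericIn (S \ B) S

/-- The orbit `Aut(F_k) w`. -/
def autOrbit {k : ℕ} (w : FG k) : Set (FG k) := {g | ∃ α : MulAut (FG k), α w = g}

/-- `u` is a cyclic permutation of `v`: the reduced word of `u` is a rotation of
the reduced word of `v`. -/
def IsCyclicPerm {k : ℕ} (u v : FG k) : Prop :=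
  ∃ n : ℕ, FreeGroup.toWord u = (FreeGroup.toWord v).rotate n

/-- `w` is a proper power: `w = uⁿ` for some `n ≥ 2`. -/
def IsProperPower {k : ℕ} (w : FG k) : Prop := ∃ (u : FG k) (n : ℕ), 2 ≤ n ∧ w = u ^ n

/-- `TS`: strictly minimal cyclically reduced `w` which are not proper powers and
are not conjugate to `τ w` for any nontrivial relabeling automorphism `τ`. -/
def TS (k : ℕ) : Set (FG k) :=
  {w | w ∈ SM k ∧ ¬ IsProperPower w ∧
    ∀ τ : MulAut (FG k), IsRelabeling τ → τ ≠ 1 → ¬ IsConj (τ w) w}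

/-- `TS'`: elements whose cyclically reduced form lies in `TS`. -/
def TS' (k : ℕ) : Set (FG k) := {g | ∃ x u : FG k, u ∈ TS k ∧ g = x * u * x⁻¹}

/-- `Z`: elements of `TS` such that no relabeling automorphism sends `w` to a cyclic
permutation of `w⁻¹`. -/
def Zset (k : ℕ) : Set (FG k) :=
  {w | w ∈ TS k ∧ ¬ ∃ τ : MulAut (FG k), IsRelabeling τ ∧ IsCyclicPerm (τ w) w⁻¹}

/-- Growth entropy `H(S) = limsup ρ(n,S)^{1/n}`. -/
noncomputable def entropyH {k : ℕ} (S : Set (FG k)) : ℝ :=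
  Filter.limsup (fun n : ℕ => (rhoC S n : ℝ) ^ ((n : ℝ)⁻¹)) Filter.atTop

/-- Number of occurrences of the two-letter word `xy` as a subword of `w`. -/
def countPair {k : ℕ} (w : List (Letter k)) (x y : Letter k) : ℕ :=
  (w.zip w.tail).count (x, y)

/-- The label `ŵ_{xy}` of the edge `[x⁻¹, y]` in the weighted Whitehead graph of the
cyclically reduced word `w`: occurrences of `xy` and of `y⁻¹x⁻¹` in `wc`, where `c` is
the first letter of `w`. -/
def whLabel {k : ℕ} (w : List (Letter k)) (x y : Letter k) : ℕ :=
  countPair (w ++ w.take 1) x y + countPair (w ++ w.take 1) (linv y) (linv x)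

/-- The one-relator group `G_u = ⟨a_1,…,a_k ∣ u = 1⟩`. -/
abbrev OneRel (k : ℕ) (u : FG k) := FG k ⧸ Subgroup.normalClosure ({u} : Set (FG k))

/-- `u` is primitive: it belongs to some free basis of `FG k`, equivalently it is the
image of a basis element under an automorphism. -/
def IsPrimitive {k : ℕ} (u : FG k) : Prop :=
  ∃ (α : MulAut (FG k)) (i : Fin k), α (FreeGroup.of i) = u

namespace WH

lemma linv_linv {k : ℕ} (x : Letter k) : linv (linv x) = x := by
  simp [linv]

lemma rel_iff {k : ℕ} (x y : Letter k) : (x.1 = y.1 → x.2 = y.2) ↔ y ≠ linv x := by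
  obtain ⟨i, b⟩ := x
  obtain ⟨j, c⟩ := y
  simp only [linv, ne_eq, Prod.mk.injEq, not_and]
  constructor
  · rintro h rfl hc
    have := h rfl
    subst hc
    cases b <;> simp at this
  · rintro h rfl
    have := h rfl
    cases b <;> cases c <;> simp_all

lemma crw_iff {k : ℕ} (w : List (Letter k)) :
    CyclicallyReducedWord w ↔ FreeGroup.IsCyclicallyReduced w := by
  unfold CyclicallyReducedWord
  rw [← FreeGroup.isReduced_iff_reduce_eq, FreeGroup.IsCyclicallyReduced, FreeGroup.IsReduced,
    List.isChain_append]
  tauto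

lemma norm_mk_of_reduced {k : ℕ} {w : List (Letter k)} (h : FreeGroup.IsReduced w) :
    (FreeGroup.mk w).norm = w.length := by
  rw [FreeGroup.norm, FreeGroup.toWord_mk, h.reduce_eq]

lemma norm_pow_le {k : ℕ} (g : FG k) (n : ℕ) : (g ^ n).norm ≤ n * g.norm := by
  induction n with
  | zero => simp
  | succ n ih =>
    rw [pow_succ]
    have := FreeGroup.norm_mul_le (g ^ n) g
    nlinarith

lemma norm_pow_eq {k : ℕ} {w : List (Letter k)} (h : FreeGroup.IsCyclicallyReduced w) (n : ℕ) :
    ((FreeGroup.mk w) ^ n).norm = n * w.length := by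
  rw [FreeGroup.pow_mk, norm_mk_of_reduced (h.flatten_replicate n).isReduced]
  simp

lemma conj_le {k : ℕ} {u : List (Letter k)} (hu : FreeGroup.IsCyclicallyReduced u)
    (x g : FG k) (h : FreeGroup.mk u = x * g * x⁻¹) : u.length ≤ g.norm := by
  by_contra hlt
  push Not at hlt
  set N := 2 * x.norm + 1 with hN
  have h1 := norm_pow_eq hu N
  rw [h, conj_pow] at h1
  have h2 := FreeGroup.norm_mul_le (x * g ^ N) x⁻¹
  have h3 := FreeGroup.norm_mul_le x (g ^ N)
  have h4 := norm_pow_le g N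
  rw [FreeGroup.norm_inv_eq] at h2
  have h5 : N * (g.norm + 1) ≤ N * u.length := Nat.mul_le_mul_left _ hlt
  have h6 : N * (g.norm + 1) = N * g.norm + N := by ring
  omega

lemma cyclicLength_conj {k : ℕ} {u : List (Letter k)} (hu : FreeGroup.IsCyclicallyReduced u)
    (y : FG k) : cyclicLength (y * FreeGroup.mk u * y⁻¹) = u.length := by
  unfold cyclicLength
  have htw : (FreeGroup.mk u).toWord = u := by
    rw [FreeGroup.toWord_mk, hu.isReduced.reduce_eq]
  have hmem : u.length ∈ {n | ∃ x v : FG k, IsCyclicallyReduced v ∧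
      y * FreeGroup.mk u * y⁻¹ = x * v * x⁻¹ ∧ wordLength v = n} := by
    refine ⟨y, FreeGroup.mk u, ?_, rfl, ?_⟩
    · rw [IsCyclicallyReduced, htw, crw_iff]; exact hu
    · rw [wordLength, htw]
  apply le_antisymm
  · exact Nat.sInf_le hmem
  · apply le_csInf ⟨_, hmem⟩
    rintro n ⟨x, v, hv, he, rfl⟩
    apply conj_le hu (y⁻¹ * x) v
    calc FreeGroup.mk u = y⁻¹ * (y * FreeGroup.mk u * y⁻¹) * y := by group
      _ = _ := by rw [he]; group

/-- the core of a letter -/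
def core {k : ℕ} (a x : Letter k) : List (Letter k) := if x.1 = a.1 then [] else [x]

/-- the connecting power -/
def conn {k : ℕ} (a : Letter k) (q : Letter k → Bool) (x y : Letter k) : List (Letter k) :=
  if q x = q (linv y) then [] else if q x = true then [a] else [linv a]

/-- the Whitehead image of a word -/
def S {k : ℕ} (a : Letter k) (q : Letter k → Bool) : List (Letter k) → List (Letter k)
  | [] => []
  | [_] => []
  | x :: y :: v => core a x ++ conn a q x y ++ S a q (y :: v)

lemma S_append {k : ℕ} (a : Letter k) (q : Letter k → Bool) (u v : List (Letter k))
    (c : Letter k) : S a q (u ++ c :: v) = S a q (u ++ [c]) ++ S a q (c :: v) := by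
  induction u with
  | nil => simp [S]
  | cons x u ih =>
    cases u with
    | nil => simp [S]
    | cons y u => simp only [List.cons_append, S, List.append_assoc] at ih ⊢; rw [ih]

lemma fst_eq_iff {k : ℕ} (a x : Letter k) : x.1 = a.1 ↔ x = a ∨ x = linv a := by
  obtain ⟨i, b⟩ := x
  obtain ⟨j, c⟩ := a
  simp only [linv, Prod.mk.injEq]
  cases b <;> cases c <;> simp

lemma cons_red {k : ℕ} (x : Letter k) (l : List (Letter k)) (h : FreeGroup.IsReduced l)
    (h' : ∀ y ∈ l.head?, y ≠ linv x) : FreeGroup.IsReduced (x :: l) := by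
  cases l with
  | nil => exact FreeGroup.IsReduced.singleton
  | cons y l =>
    rw [FreeGroup.isReduced_cons_cons, rel_iff]
    exact ⟨h' y (by simp), h⟩

lemma S_red {k : ℕ} (a : Letter k) (q : Letter k → Bool) (hqa : q a = true)
    (hqa' : q (linv a) = false) (v : List (Letter k)) (y : Letter k)
    (hv : FreeGroup.IsReduced (y :: v)) :
    FreeGroup.IsReduced (S a q (y :: v)) ∧ ∀ h ∈ (S a q (y :: v)).head?,
      h = y ∨ (y.1 = a.1 ∧ h.1 ≠ a.1 ∧ q (linv h) = q y) := by
  induction v generalizing y with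
  | nil => simp [S]
  | cons z v ih =>
    rw [FreeGroup.isReduced_cons_cons, rel_iff] at hv
    obtain ⟨hyz, hv⟩ := hv
    obtain ⟨ih1, ih2⟩ := ih z hv
    have hla : linv (linv a) = a := linv_linv a
    have hal : a ≠ linv a := by intro h; rw [← h, hqa] at hqa'; cases hqa'
    rw [S]
    by_cases hy : y.1 = a.1
    · rw [core, if_pos hy, List.nil_append]
      have hz : ∀ t : Letter k, t.1 = a.1 → t = y ∨ t = linv y := by
        intro t ht; rw [← fst_eq_iff, ht, hy]
      have hqy : q (linv y) ≠ q y := by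
        rcases (fst_eq_iff a y).1 hy with rfl | rfl
        · simp [hqa, hqa']
        · simp [hqa, hqa', hla]
      unfold conn
      split_ifs with h1 h2
      · rw [List.nil_append]
        refine ⟨ih1, fun h hh => ?_⟩
        have hza : z.1 ≠ a.1 := by
          intro hz'
          rcases hz z hz' with rfl | rfl
          · exact hqy h1.symm
          · exact hyz rfl
        rcases ih2 h hh with rfl | ⟨h3, _⟩
        · exact Or.inr ⟨hy, hza, h1.symm⟩
        · exact absurd h3 hza
      · have : y = a := by
          rcases (fst_eq_iff a y).1 hy with rfl | rfl
          · rfl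
          · simp [hqa'] at h2
        subst this
        refine ⟨cons_red _ _ ih1 fun h hh => ?_, by simp⟩
        rcases ih2 h hh with rfl | ⟨h3, h4, _⟩
        · exact hyz
        · rintro rfl; exact h4 rfl
      · have : y = linv a := by
          rcases (fst_eq_iff a y).1 hy with rfl | rfl
          · simp [hqa] at h2
          · rfl
        subst this
        refine ⟨cons_red _ _ ih1 fun h hh => ?_, by simp⟩
        rcases ih2 h hh with rfl | ⟨h3, h4, _⟩
        · exact hyz
        · rintro rfl; exact h4 rfl
    · rw [core, if_neg hy]
      refine ⟨?_, by simp⟩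
      have hyl : ∀ t : Letter k, t.1 = a.1 → t ≠ linv y := by
        rintro t ht rfl; exact hy ht
      unfold conn
      split_ifs with h1 h2
      · refine cons_red _ _ ih1 fun h hh => ?_
        rcases ih2 h hh with rfl | ⟨h3, h4, h5⟩
        · exact hyz
        · rintro rfl
          rw [linv_linv] at h5
          rcases (fst_eq_iff a z).1 h3 with rfl | rfl
          · simp_all
          · simp_all
      · refine cons_red _ _ (cons_red _ _ ih1 fun h hh => ?_) ?_
        · rcases ih2 h hh with rfl | ⟨h3, h4, h5⟩
          · rintro rfl; rw [hla, hqa] at h1; exact h1 h2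
          · rintro rfl; exact h4 rfl
        · intro t ht
          obtain rfl : a = t := by simpa using ht
          exact hyl _ rfl
      · refine cons_red _ _ (cons_red _ _ ih1 fun h hh => ?_) ?_
        · rw [hla]
          rcases ih2 h hh with rfl | ⟨h3, h4, h5⟩
          · rintro rfl; rw [hqa'] at h1; simp at h2; exact h1 h2
          · rintro rfl; exact h4 rfl
        · intro t ht
          obtain rfl : linv a = t := by simpa using ht
          exact hyl _ rfl

/-- `a` or `1` -/
def pw {k : ℕ} (a : Letter k) (b : Bool) : FG k := if b then FreeGroup.mk [a] else 1

lemma mk_linv {k : ℕ} (a : Letter k) : FreeGroup.mk [linv a] = (FreeGroup.mk [a])⁻¹ := by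
  rw [FreeGroup.inv_mk]; simp [FreeGroup.invRev, linv]

lemma mk_conn {k : ℕ} (a : Letter k) (q : Letter k → Bool) (x y : Letter k) :
    FreeGroup.mk (conn a q x y) = pw a (q x) * (pw a (q (linv y)))⁻¹ := by
  unfold conn pw
  have h1 : (FreeGroup.mk [] : FG k) = 1 := rfl
  have h2 := mk_linv a
  cases hx : q x <;> cases hy : q (linv y) <;>
    simp only [if_true, if_false, reduceCtorEq, Bool.false_eq_true, h1, h2] <;> group

lemma tau_S {k : ℕ} (a : Letter k) (q : Letter k → Bool) (τ : MulAut (FG k))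
    (hτ : ∀ x, τ (FreeGroup.mk [x]) =
      (pw a (q (linv x)))⁻¹ * FreeGroup.mk (core a x) * pw a (q x))
    (v : List (Letter k)) (x z : Letter k) :
    τ (FreeGroup.mk (x :: v)) = (pw a (q (linv x)))⁻¹ *
      FreeGroup.mk (S a q (x :: v ++ [z])) * pw a (q (linv z)) := by
  induction v generalizing x with
  | nil =>
    simp only [List.cons_append, List.nil_append, S, List.append_nil]
    rw [hτ, ← FreeGroup.mul_mk, mk_conn]; group
  | cons y v ih =>
    have : FreeGroup.mk (x :: y :: v) = FreeGroup.mk [x] * FreeGroup.mk (y :: v) := by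
      rw [FreeGroup.mul_mk]; rfl
    rw [this, map_mul, hτ, ih]
    simp only [List.cons_append, S]
    rw [← FreeGroup.mul_mk, ← FreeGroup.mul_mk, mk_conn]; group

lemma S_length {k : ℕ} (a : Letter k) (q : Letter k → Bool) (hal : a ≠ linv a)
    (v : List (Letter k)) (z : Letter k) :
    (S a q (v ++ [z])).length + (v.count a + v.count (linv a)) = v.length +
      ((v ++ [z]).zip (v ++ [z]).tail).countP (fun p => decide (q p.1 ≠ q (linv p.2))) := by
  have hx : ∀ x : Letter k, (core a x).length + (([x] : List (Letter k)).count a +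
      ([x] : List (Letter k)).count (linv a)) = 1 := by
    intro x
    unfold core
    split_ifs with h
    · rcases (fst_eq_iff a x).1 h with rfl | rfl
      · simp [hal]
      · simp [hal.symm]
    · have h1 : x ≠ a := by rintro rfl; exact h rfl
      have h2 : x ≠ linv a := by rintro rfl; exact h rfl
      simp [h1, h2]
  have hc : ∀ x y : Letter k, (conn a q x y).length =
      ([(x, y)] : List (Letter k × Letter k)).countP
        (fun p => decide (q p.1 ≠ q (linv p.2))) := by
    intro x y
    unfold conn
    split_ifs with h1 h2 <;> simp [h1]
  have key : ∀ (x y : Letter k) (t : List (Letter k)) (r : List (Letter k × Letter k)),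
      ((x :: t).count a + (x :: t).count (linv a)) = (([x] : List (Letter k)).count a +
        ([x] : List (Letter k)).count (linv a)) + (t.count a + t.count (linv a)) ∧
      ((x, y) :: r).countP (fun p => decide (q p.1 ≠ q (linv p.2))) =
        ([(x, y)] : List (Letter k × Letter k)).countP
          (fun p => decide (q p.1 ≠ q (linv p.2))) +
        r.countP (fun p => decide (q p.1 ≠ q (linv p.2))) := by
    intro x y t r
    refine ⟨?_, ?_⟩
    · simp only [List.count_cons, List.count_nil]; omega
    · simp only [List.countP_cons, List.countP_nil]; omega
  induction v with
  | nil => simp [S]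
  | cons x v ih =>
    cases v with
    | nil =>
      have h1 := hx x
      have h2 := hc x z
      simp only [List.cons_append, List.nil_append, S, List.append_nil, List.tail_cons,
        List.zip_cons_cons, List.length_append, List.length_cons, List.length_nil,
        List.zip_nil_right]
      omega
    | cons y v =>
      have h1 := hx x
      have h2 := hc x y
      obtain ⟨h3, h4⟩ := key x y (y :: v) ((y :: v ++ [z]).zip (v ++ [z]))
      simp only [List.cons_append, S, List.tail_cons, List.zip_cons_cons, List.length_append,
        List.length_cons] at ih h3 h4 ⊢
      omega

lemma of_eq {k : ℕ} (i : Fin k) : (FreeGroup.of i : FG k) = FreeGroup.mk [(i, true)] := rfl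

lemma exists_data {k : ℕ} (τ : MulAut (FG k)) (h : IsWhitehead2 τ) :
    ∃ (a : Letter k) (q : Letter k → Bool), q a = true ∧ q (linv a) = false ∧
      (∀ x, x.1 = a.1 → τ (FreeGroup.mk [x]) = FreeGroup.mk [x]) ∧
      ∀ x, τ (FreeGroup.mk [x]) =
      (pw a (q (linv x)))⁻¹ * FreeGroup.mk (core a x) * pw a (q x) := by
  obtain ⟨g, hg, hτg, hτ⟩ := h
  obtain ⟨a, rfl⟩ : ∃ a : Letter k, g = FreeGroup.mk [a] := by
    obtain ⟨i, rfl | rfl⟩ := hg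
    · exact ⟨(i, true), rfl⟩
    · exact ⟨linv (i, true), by rw [mk_linv]; rfl⟩
  have hal : linv a ≠ a := by
    intro h
    have := congrArg Prod.snd h
    simp [linv] at this
  have hex : ∀ i : Fin k, ∃ b c : Bool,
      τ (FreeGroup.of i) = (pw a c)⁻¹ * FreeGroup.of i * pw a b := by
    intro i
    rcases hτ (FreeGroup.of i) ⟨i, Or.inl rfl⟩ with h | h | h | h
    · exact ⟨false, false, by simp [h, pw]⟩
    · exact ⟨true, false, by simp [h, pw]⟩
    · exact ⟨false, true, by simp only [h, pw]; simp⟩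
    · exact ⟨true, true, by simp only [h, pw]; simp⟩
  choose b c hbc using hex
  have hfix : ∀ x : Letter k, x.1 = a.1 → τ (FreeGroup.mk [x]) = FreeGroup.mk [x] := by
    intro x hx
    rcases (fst_eq_iff a x).1 hx with rfl | rfl
    · exact hτg
    · rw [mk_linv, map_inv, hτg]
  refine ⟨a, fun x => if x.1 = a.1 then decide (x = a) else if x.2 then b x.1 else c x.1,
    by simp, ?_, hfix, ?_⟩
  · have : (linv a).1 = a.1 := rfl
    simp [this, hal]
  · intro x
    by_cases hx : x.1 = a.1
    · have hx' : (linv x).1 = a.1 := hx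
      have h1 : (FreeGroup.mk [] : FG k) = 1 := rfl
      rw [hfix x hx, core, if_pos hx, h1]
      simp only [hx, hx', if_true]
      rcases (fst_eq_iff a x).1 hx with rfl | rfl
      · simp only [hal, pw]; simp
      · simp only [hal, pw, linv_linv, mk_linv]; simp
    · have hx' : ¬ (linv x).1 = a.1 := hx
      rw [core, if_neg hx]
      simp only [hx, hx', if_false]
      obtain ⟨i, s⟩ := x
      cases s
      · have h1 : FreeGroup.mk [((i, false) : Letter k)] = (FreeGroup.of i)⁻¹ :=
          mk_linv (i, true)
        rw [h1, map_inv, hbc]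
        simp only [linv]
        simp only [Bool.not_false, if_true, Bool.false_eq_true, if_false]
        group
      · rw [← of_eq, hbc]
        simp only [linv]
        simp

lemma inner_of_const {k : ℕ} (τ : MulAut (FG k)) (a : Letter k) (q : Letter k → Bool)
    (hfix : ∀ x, x.1 = a.1 → τ (FreeGroup.mk [x]) = FreeGroup.mk [x])
    (hτ : ∀ x, τ (FreeGroup.mk [x]) =
      (pw a (q (linv x)))⁻¹ * FreeGroup.mk (core a x) * pw a (q x))
    (b : Bool) (hb : ∀ x, x.1 ≠ a.1 → q x = b) : IsInner τ := by
  refine ⟨(pw a b)⁻¹, ?_⟩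
  have key : τ.toMonoidHom = (MulAut.conj (pw a b)⁻¹).toMonoidHom := by
    apply FreeGroup.ext_hom
    intro i
    change τ (FreeGroup.of i) = MulAut.conj (pw a b)⁻¹ (FreeGroup.of i)
    rw [of_eq, MulAut.conj_apply, inv_inv]
    by_cases hi : i = a.1
    · rw [hfix (i, true) hi]
      rcases (fst_eq_iff a (i, true)).1 hi with h | h
      · rw [h]; unfold pw; cases b <;> simp only [if_true, Bool.false_eq_true, if_false] <;> group
      · rw [h, mk_linv]; unfold pw
        cases b <;> simp only [if_true, Bool.false_eq_true, if_false] <;> group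
    · rw [hτ, hb (i, true) hi, hb (linv (i, true)) hi, core, if_neg hi]
  ext1 g
  exact DFunLike.congr_fun key g

lemma countP_eq_sum {k : ℕ} (P : List (Letter k × Letter k))
    (r : Letter k × Letter k → Bool) :
    P.countP r = ∑ p ∈ Finset.univ.filter (fun p => r p = true), P.count p := by
  induction P with
  | nil => simp
  | cons x P ih =>
    simp only [List.countP_cons, List.count_cons, Finset.sum_add_distrib, ih, beq_iff_eq]
    congr 1
    rw [Finset.sum_ite_eq]
    simp

/-- edges in the cut -/
def D {k : ℕ} (q : Letter k → Bool) : Finset (Letter k × Letter k) :=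
  Finset.univ.filter (fun p => q p.1 = true ∧ q (linv p.2) = false)

lemma countP_cut {k : ℕ} (q : Letter k → Bool) (P : List (Letter k × Letter k)) :
    P.countP (fun p => decide (q p.1 ≠ q (linv p.2))) =
      ∑ p ∈ D q, (P.count (p.1, p.2) + P.count (linv p.2, linv p.1)) := by
  rw [countP_eq_sum, Finset.sum_add_distrib]
  have h2 : ∑ p ∈ D q, P.count (linv p.2, linv p.1) =
      ∑ p ∈ Finset.univ.filter
        (fun p : Letter k × Letter k => q p.1 = false ∧ q (linv p.2) = true), P.count p := by
    refine Finset.sum_bij' (fun p _ => (linv p.2, linv p.1)) (fun p _ => (linv p.2, linv p.1))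
      ?_ ?_ ?_ ?_ ?_ <;> simp (config := { contextual := true }) [D, linv_linv]
  simp only [Prod.mk.eta]
  rw [h2, D, ← Finset.sum_union]
  · refine Finset.sum_congr ?_ fun _ _ => rfl
    ext p
    simp only [Finset.mem_filter, Finset.mem_univ, true_and, Finset.mem_union]
    cases q p.1 <;> cases q (linv p.2) <;> simp
  · rw [Finset.disjoint_filter]
    rintro p - ⟨h1, -⟩ ⟨h3, -⟩
    rw [h1] at h3; cases h3

lemma card_D {k : ℕ} (hk : 2 ≤ k) (q : Letter k → Bool) (a b c d : Letter k) (hab : a ≠ b)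
    (ha : q a = true) (hb : q b = true) (hcd : c ≠ d) (hc : q c = false) (hd : q d = false) :
    4 * (k - 1) ≤ (D q).card := by
  set A := Finset.univ.filter (fun x : Letter k => q x = true) with hA
  set B := Finset.univ.filter (fun x : Letter k => ¬ q x = true) with hB
  have hAB : A.card + B.card = 2 * k := by
    rw [hA, hB, Finset.card_filter_add_card_filter_not]
    simp [mul_comm]
  have h1 : 2 ≤ A.card := by
    rw [← Finset.card_pair hab]
    apply Finset.card_le_card
    intro x; simp only [Finset.mem_insert, Finset.mem_singleton]
    rintro (rfl | rfl) <;> simp [hA, ha, hb]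
  have h2 : 2 ≤ B.card := by
    rw [← Finset.card_pair hcd]
    apply Finset.card_le_card
    intro x; simp only [Finset.mem_insert, Finset.mem_singleton]
    rintro (rfl | rfl) <;> simp [hB, hc, hd]
  have h3 : (A ×ˢ B).card ≤ (D q).card := by
    refine Finset.card_le_card_of_injOn (fun p => (p.1, linv p.2)) ?_ ?_
    · rintro ⟨x, y⟩ h
      simpa [D, linv_linv, hA, hB] using h
    · rintro ⟨x, y⟩ _ ⟨x', y'⟩ _ h
      simp only [Prod.mk.injEq] at h ⊢
      refine ⟨h.1, ?_⟩
      rw [← linv_linv y, h.2, linv_linv]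
  rw [Finset.card_product] at h3
  refine le_trans ?_ h3
  obtain ⟨k, rfl⟩ : ∃ m, k = m + 1 := ⟨k - 1, by omega⟩
  obtain ⟨s, hs⟩ := Nat.exists_eq_add_of_le h1
  obtain ⟨t, ht⟩ := Nat.exists_eq_add_of_le h2
  rw [hs, ht] at hAB ⊢
  simp only [Nat.add_sub_cancel]
  nlinarith [Nat.zero_le (s * t)]

lemma main_ineq {k : ℕ} (hk : 2 ≤ k) (ε : ℝ) (hε0 : 0 < ε)
    (hε1 : ε < (2 * (k : ℝ) - 3) / ((k : ℝ) * (2 * (k : ℝ) - 1) * (4 * (k : ℝ) - 3)))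
    (n C : ℕ) (hn : 0 < n) (c1 c2 d : ℕ) (hd : 4 * (k - 1) ≤ d)
    (h1 : (c1 : ℝ) / n < 1 / (2 * (k : ℝ)) + ε / 2)
    (h2 : (c2 : ℝ) / n < 1 / (2 * (k : ℝ)) + ε / 2)
    (hC : (d : ℝ) * (n * (1 / ((k : ℝ) * (2 * (k : ℝ) - 1)) - ε)) ≤ C) : c1 + c2 < C := by
  have hk' : (2 : ℝ) ≤ k := by exact_mod_cast hk
  have hn' : (0 : ℝ) < n := by exact_mod_cast hn
  have p1 : (0 : ℝ) < k * (2 * k - 1) := by nlinarith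
  have p2 : (0 : ℝ) < 4 * k - 3 := by linarith
  set u : ℝ := 1 / ((k : ℝ) * (2 * (k : ℝ) - 1)) with hu
  have hup : 0 < u := by positivity
  have e1 : ε * (4 * k - 3) < (2 * k - 3) * u := by
    rw [lt_div_iff₀ (mul_pos p1 p2)] at hε1
    rw [hu, mul_one_div, lt_div_iff₀ p1]
    linarith
  have e2 : 1 / (2 * (k : ℝ)) = (2 * k - 1) * u / 2 := by
    rw [hu]
    have : (2 * (k : ℝ) - 1) ≠ 0 := by linarith
    field_simp
  have e3 : 0 < u - ε := by nlinarith
  have hd' : (4 * ((k : ℝ) - 1)) ≤ d := by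
    have : ((4 * (k - 1) : ℕ) : ℝ) ≤ d := by exact_mod_cast hd
    rw [Nat.cast_mul, Nat.cast_sub (by omega)] at this
    simpa using this
  rw [div_lt_iff₀ hn', e2] at h1 h2
  have h3 : (4 * ((k : ℝ) - 1)) * (n * (u - ε)) ≤ d * (n * (u - ε)) :=
    mul_le_mul_of_nonneg_right hd' (by positivity)
  have h4 : n * ((2 * k - 1) * u + ε) < n * (4 * ((k : ℝ) - 1) * (u - ε)) := by
    apply mul_lt_mul_of_pos_left _ hn'
    linarith
  have : ((c1 + c2 : ℕ) : ℝ) < C := by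
    push_cast
    linarith
  exact_mod_cast this

end WH

/-- Strict Minimality Criterion: if every letter frequency of the
cyclically reduced word `w` is within `ε/2` of `1/(2k)` and every weighted Whitehead
graph edge label frequency is within `ε` of `1/(k(2k−1))`, where
`0 < ε < (2k−3)/(k(2k−1)(4k−3))`, then `‖τ w‖ > ‖w‖ = |w|` for every non-inner
Whitehead automorphism `τ` of the second kind, i.e. `w` is strictly minimal. -/
theorem strict_minimality_criterion (k : ℕ) (hk : 2 ≤ k) (ε : ℝ)
    (hε0 : 0 < ε)
    (hε1 : ε < (2 * (k : ℝ) - 3) / ((k : ℝ) * (2 * (k : ℝ) - 1) * (4 * (k : ℝ) - 3)))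
    (w : List (Letter k)) (hw : CyclicallyReducedWord w)
    (ha : ∀ x : Letter k,
      1 / (2 * (k : ℝ)) - ε / 2 < (w.count x : ℝ) / w.length ∧
      (w.count x : ℝ) / w.length < 1 / (2 * (k : ℝ)) + ε / 2)
    (hb : ∀ x y : Letter k, y ≠ linv x →
      1 / ((k : ℝ) * (2 * (k : ℝ) - 1)) - ε < (whLabel w x y : ℝ) / w.length ∧
      (whLabel w x y : ℝ) / w.length < 1 / ((k : ℝ) * (2 * (k : ℝ) - 1)) + ε) :
    (∀ τ : MulAut (FG k), IsWhitehead2 τ → ¬ IsInner τ →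
      w.length < cyclicLength (τ (FreeGroup.mk w))) ∧
    cyclicLength (FreeGroup.mk w) = w.length ∧
    wordLength (FreeGroup.mk w) = w.length ∧
    FreeGroup.mk w ∈ SM k := by
  have hcr := (WH.crw_iff w).1 hw
  have hcl : cyclicLength (FreeGroup.mk w) = w.length := by
    simpa using WH.cyclicLength_conj hcr 1
  have htw : (FreeGroup.mk w).toWord = w := by
    rw [FreeGroup.toWord_mk, hcr.isReduced.reduce_eq]
  have hwl : wordLength (FreeGroup.mk w) = w.length := by rw [wordLength, htw]
  have main : ∀ τ : MulAut (FG k), IsWhitehead2 τ → ¬ IsInner τ →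
      w.length < cyclicLength (τ (FreeGroup.mk w)) := by
    intro τ hτ hni
    obtain ⟨a, q, hqa, hqa', hfix, hτ⟩ := WH.exists_data τ hτ
    have hal : a ≠ linv a := by intro h; rw [← h, hqa] at hqa'; cases hqa'
    have hA : ∃ b, a ≠ b ∧ q b = true := by
      by_contra hcon
      push Not at hcon
      refine hni (WH.inner_of_const τ a q hfix hτ false fun x hx => ?_)
      simpa using hcon x (by rintro rfl; exact hx rfl)
    have hB : ∃ b, linv a ≠ b ∧ q b = false := by
      by_contra hcon
      push Not at hcon
      refine hni (WH.inner_of_const τ a q hfix hτ true fun x hx => ?_)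
      simpa using hcon x (by rintro rfl; exact hx rfl)
    obtain ⟨b, hab, hqb⟩ := hA
    obtain ⟨c, hac, hqc⟩ := hB
    have hD := WH.card_D hk q a b (linv a) c hab hqa hqb hac hqa' hqc
    cases hwe : w with
    | nil =>
      exfalso
      have h1 := (ha a).1
      have h2 := WH.main_ineq hk ε hε0 hε1 1 0 one_pos 0 0 (4 * (k - 1)) le_rfl
      have hk' : (2 : ℝ) ≤ k := by exact_mod_cast hk
      have h3 := (hb a a hal).1
      simp only [hwe, List.length_nil, Nat.cast_zero, div_zero] at h1 h3
      have h4 : (0:ℝ) < 1 / (2 * (k : ℝ)) + ε / 2 := by positivity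
      refine absurd (h2 (by simpa using h4) (by simpa using h4) ?_) (lt_irrefl _)
      have h5 : (0 : ℝ) ≤ ((4 * (k - 1) : ℕ) : ℝ) := Nat.cast_nonneg _
      simp only [Nat.cast_one, one_mul, Nat.cast_zero]
      exact mul_nonpos_of_nonneg_of_nonpos h5 h3.le
    | cons z t =>
      have hn : 0 < w.length := by rw [hwe]; simp
      have hn' : (0 : ℝ) < w.length := by exact_mod_cast hn
      rw [← hwe]
      have htake : w.take 1 = [z] := by rw [hwe]; rfl
      have hww : FreeGroup.IsReduced (w ++ w) := FreeGroup.isReduced_iff_reduce_eq.2 hw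
      have hwz : FreeGroup.IsReduced (w ++ [z]) :=
        hww.infix ⟨[], t, by rw [hwe]; simp⟩
      have hwwz : FreeGroup.IsReduced (w ++ w ++ [z]) :=
        FreeGroup.IsReduced.append_overlap hww hwz (by rw [hwe]; simp)
      have hSS : WH.S a q (w ++ w ++ [z]) = WH.S a q (w ++ [z]) ++ WH.S a q (w ++ [z]) := by
        have := WH.S_append a q w (t ++ [z]) z
        have e : w ++ w ++ [z] = w ++ z :: (t ++ [z]) := by
          rw [List.append_assoc]; congr 1; rw [hwe]; rfl
        have e' : z :: (t ++ [z]) = w ++ [z] := by rw [hwe]; rfl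
        rw [e, this, e']
      have hSc : FreeGroup.IsCyclicallyReduced (WH.S a q (w ++ [z])) := by
        rw [← WH.crw_iff, CyclicallyReducedWord, ← FreeGroup.isReduced_iff_reduce_eq, ← hSS]
        have e : w ++ w ++ [z] = z :: (t ++ w ++ [z]) := by
          conv_lhs => rw [hwe]
          rw [hwe]; simp
        rw [e] at hwwz ⊢
        exact (WH.S_red a q hqa hqa' _ _ hwwz).1
      have hlen : cyclicLength (τ (FreeGroup.mk w)) = (WH.S a q (w ++ [z])).length := by
        have h1 := WH.tau_S a q τ hτ t z z
        have h2 := WH.cyclicLength_conj hSc (WH.pw a (q (linv z)))⁻¹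
        rw [inv_inv] at h2
        rw [← h2, hwe, h1]
      rw [hlen]
      have hSl := WH.S_length a q hal w z
      rw [WH.countP_cut] at hSl
      set C := ∑ p ∈ WH.D q, (((w ++ [z]).zip (w ++ [z]).tail).count (p.1, p.2) +
        ((w ++ [z]).zip (w ++ [z]).tail).count (linv p.2, linv p.1)) with hC
      have hCw : C = ∑ p ∈ WH.D q, whLabel w p.1 p.2 := by
        rw [hC]
        refine Finset.sum_congr rfl fun p _ => ?_
        rw [whLabel, htake]; rfl
      have hfin : w.count a + w.count (linv a) < C := by
        refine WH.main_ineq hk ε hε0 hε1 w.length C hn _ _ _ hD (ha a).2 (ha (linv a)).2 ?_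
        rw [hCw, Nat.cast_sum, ← nsmul_eq_mul]
        apply Finset.card_nsmul_le_sum
        intro p hp
        have hp' := (Finset.mem_filter.1 hp).2
        have hne : p.2 ≠ linv p.1 := by
          intro h
          rw [h, WH.linv_linv, hp'.1] at hp'
          cases hp'.2
        have := (hb p.1 p.2 hne).1
        rw [lt_div_iff₀ hn'] at this
        linarith
      omega
  refine ⟨main, hcl, hwl, ?_, ?_⟩
  · rw [IsCyclicallyReduced, htw]; exact hw
  · intro τ h1 h2
    rw [hwl]; exact main τ h1 h2
end

section
/- For any ε > 0 and any letter a ∈ Σ, the proportion of freely reduced words of length n with letter frequency of a close to 1/(2k) tends to 1 exponentially fast: #{w ∈ F_k : |w| = n and w_a/n ∈ (1/(2k) − ε, 1/(2k) + ε)} / γ(n,F_k) → 1 as n → ∞, and the convergence is exponentially fast (there exist K > 0 and 0 < σ < 1 with |1 − ratio| ≤ K σ^n). -/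
open Finset in
/-- words of length `n+1` starting with `x` -/
def RW {k : ℕ} : ℕ → Letter k → Finset (List (Letter k))
  | 0, x => {[x]}
  | n+1, x => (univ.erase (linv x)).biUnion (fun y => (RW n y).image (fun w => x :: w))

theorem RW_head {k : ℕ} (n : ℕ) (x : Letter k) (w : List (Letter k)) (h : w ∈ RW n x) :
    w.head? = some x := by
  cases n with
  | zero => simp [RW] at h; simp [h]
  | succ n =>
    simp only [RW, Finset.mem_biUnion, Finset.mem_image] at h
    obtain ⟨y, -, v, -, rfl⟩ := h
    rfl

theorem RW_disj {k : ℕ} (n : ℕ) (x y : Letter k) (hxy : x ≠ y) :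
    Disjoint (RW n x) (RW n y) := by
  rw [Finset.disjoint_left]
  intro w h1 h2
  have a1 := RW_head n x w h1
  have a2 := RW_head n y w h2
  rw [a1] at a2
  exact hxy (Option.some.inj a2)

theorem RW_mem {k : ℕ} (n : ℕ) (x : Letter k) (w : List (Letter k)) :
    w ∈ RW n x ↔ FreeGroup.IsReduced w ∧ w.length = n + 1 ∧ w.head? = some x := by
  induction n generalizing x w with
  | zero =>
    simp only [RW, Finset.mem_singleton]
    constructor
    · rintro rfl; simp
    · rintro ⟨-, h1, h2⟩
      match w, h1, h2 with
      | [z], _, h2 => simpa using h2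
  | succ n ih =>
    simp only [RW, Finset.mem_biUnion, Finset.mem_image, Finset.mem_erase, Finset.mem_univ,
      and_true, ih]
    constructor
    · rintro ⟨y, hy, v, ⟨h1, h2, h3⟩, rfl⟩
      match v, h1, h2, h3 with
      | z :: v, h1, h2, h3 =>
        simp only [List.head?_cons, Option.some.injEq] at h3
        subst h3
        refine ⟨?_, by simpa using h2, rfl⟩
        rw [FreeGroup.isReduced_cons_cons]
        refine ⟨?_, h1⟩
        intro h
        by_contra hne
        apply hy
        unfold linv
        ext1
        · exact h.symm
        · revert hne; cases x.2 <;> cases z.2 <;> simp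
    · rintro ⟨h1, h2, h3⟩
      match w, h1, h2, h3 with
      | u :: z :: v, h1, h2, h3 =>
        simp only [List.head?_cons, Option.some.injEq] at h3
        subst h3
        rw [FreeGroup.isReduced_cons_cons] at h1
        refine ⟨z, ?_, z :: v, ⟨h1.2, by simpa using h2, rfl⟩, rfl⟩
        rintro rfl
        have := h1.1 rfl
        simp [linv] at this

theorem RW_sum {k : ℕ} (n : ℕ) (x : Letter k) (g : List (Letter k) → ℝ) :
    ∑ w ∈ RW (n+1) x, g w = ∑ y ∈ Finset.univ.erase (linv x), ∑ w ∈ RW n y, g (x :: w) := by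
  rw [RW, Finset.sum_biUnion]
  · refine Finset.sum_congr rfl fun y _ => ?_
    rw [Finset.sum_image]
    intro a _ b _ h
    simpa using h
  · intro y _ z _ hyz
    simp only [Function.onFun]
    rw [Finset.disjoint_image (List.cons_injective)]
    exact RW_disj n y z hyz

theorem erase_card {k : ℕ} (hk : 2 ≤ k) (x : Letter k) :
    ((Finset.univ.erase (linv x)).card : ℝ) = 2 * (k:ℝ) - 1 := by
  rw [Finset.card_erase_of_mem (Finset.mem_univ _)]
  rw [Nat.cast_sub]
  · simp; ring
  · simp; omega

theorem RW_card {k : ℕ} (hk : 2 ≤ k) (n : ℕ) (x : Letter k) :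
    ((RW n x).card : ℝ) = (2 * (k:ℝ) - 1) ^ n := by
  induction n generalizing x with
  | zero => simp [RW]
  | succ n ih =>
    have := RW_sum n x (fun _ => 1)
    simp only [Finset.sum_const, nsmul_eq_mul, mul_one, ih] at this
    rw [this, erase_card hk]; ring

theorem exp_step {k : ℕ} (hk : 2 ≤ k) (h : Letter k → ℝ) (hh : ∀ x, |h x| ≤ 2)
    (t : ℝ) (ht : |t| ≤ 1/4) (x : Letter k) (c : ℝ)
    (hc : (2 * (k:ℝ) - 1) * c = ∑ y ∈ Finset.univ.erase (linv x), h y) :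
    ∑ y ∈ Finset.univ.erase (linv x), Real.exp (t * (h y - c))
      ≤ (2 * (k:ℝ) - 1) * Real.exp (16 * t^2) := by
  have hk' : (2:ℝ) ≤ k := by exact_mod_cast hk
  have hq : 0 < 2 * (k:ℝ) - 1 := by linarith
  have hc2 : |c| ≤ 2 := by
    have h1 : |(2 * (k:ℝ) - 1) * c| ≤ (2 * (k:ℝ) - 1) * 2 := by
      rw [hc, ← erase_card hk x, ← nsmul_eq_mul, ← Finset.sum_const]
      exact (Finset.abs_sum_le_sum_abs _ _).trans (Finset.sum_le_sum fun y _ => hh y)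
    rw [abs_mul, abs_of_pos hq] at h1
    exact le_of_mul_le_mul_left h1 hq
  have key : ∀ y, Real.exp (t * (h y - c)) ≤ 1 + t * (h y - c) + 16 * t^2 := by
    intro y
    have hu : |h y - c| ≤ 4 := by
      have := abs_sub (h y) c
      have := hh y
      linarith
    have h1 : |t * (h y - c)| ≤ 1 := by
      rw [abs_mul]
      nlinarith [abs_nonneg t, abs_nonneg (h y - c)]
    have h2 := (abs_le.1 (Real.abs_exp_sub_one_sub_id_le h1)).2
    have h3 : (h y - c)^2 ≤ 16 := by
      have := abs_le.1 hu
      nlinarith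
    nlinarith [sq_nonneg t]
  calc _ ≤ ∑ y ∈ Finset.univ.erase (linv x), (1 + t * (h y - c) + 16 * t^2) :=
        Finset.sum_le_sum fun y _ => key y
    _ = (2 * (k:ℝ) - 1) * (1 + 16 * t^2) := by
        simp only [Finset.sum_add_distrib, ← Finset.mul_sum, Finset.sum_sub_distrib,
          Finset.sum_const, nsmul_eq_mul, erase_card hk, ← hc]
        ring
    _ ≤ _ := by
        apply mul_le_mul_of_nonneg_left _ hq.le
        have := Real.add_one_le_exp (16 * t^2)
        linarith

theorem mgf_bound {k : ℕ} (hk : 2 ≤ k) (f h : Letter k → ℝ) (hh : ∀ x, |h x| ≤ 2)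
    (hf : ∀ x, |f x| ≤ 1)
    (hfh : ∀ x, (2 * (k:ℝ) - 1) * (h x - f x) = ∑ y ∈ Finset.univ.erase (linv x), h y)
    (t : ℝ) (ht : |t| ≤ 1/4) (n : ℕ) (x : Letter k) :
    ∑ w ∈ RW n x, Real.exp (t * (w.map f).sum) ≤
      Real.exp (t * h x) * (Real.exp 1 * ((2 * (k:ℝ) - 1) * Real.exp (16 * t^2)) ^ n) := by
  have hk' : (2:ℝ) ≤ k := by exact_mod_cast hk
  have hq : 0 < 2 * (k:ℝ) - 1 := by linarith
  induction n generalizing x with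
  | zero =>
    simp only [RW, Finset.sum_singleton, pow_zero, mul_one, ← Real.exp_add, List.map_cons,
      List.map_nil, List.sum_cons, List.sum_nil, add_zero]
    apply Real.exp_le_exp.2
    have hu : |f x - h x| ≤ 3 := by
      have := abs_sub (f x) (h x)
      have := hh x
      have := hf x
      linarith
    have h1 : |t * (f x - h x)| ≤ 1 := by
      rw [abs_mul]
      nlinarith [abs_nonneg t, abs_nonneg (f x - h x)]
    have := (abs_le.1 h1).2
    linarith
  | succ n ih =>
    rw [RW_sum]
    set D := Real.exp 1 * ((2 * (k:ℝ) - 1) * Real.exp (16 * t^2)) ^ n with hD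
    have hD0 : 0 ≤ D := by positivity
    calc _ = ∑ y ∈ Finset.univ.erase (linv x), Real.exp (t * f x) *
              ∑ w ∈ RW n y, Real.exp (t * (w.map f).sum) := by
            refine Finset.sum_congr rfl fun y _ => ?_
            rw [Finset.mul_sum]
            refine Finset.sum_congr rfl fun w _ => ?_
            rw [← Real.exp_add]; simp [mul_add]
      _ ≤ ∑ y ∈ Finset.univ.erase (linv x), Real.exp (t * f x) * (Real.exp (t * h y) * D) :=
            Finset.sum_le_sum fun y _ => mul_le_mul_of_nonneg_left (ih y) (Real.exp_pos _).le
      _ = Real.exp (t * h x) * D *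
            ∑ y ∈ Finset.univ.erase (linv x), Real.exp (t * (h y - (h x - f x))) := by
            rw [Finset.mul_sum]
            refine Finset.sum_congr rfl fun y _ => ?_
            have : Real.exp (t * h x) * D * Real.exp (t * (h y - (h x - f x)))
              = (Real.exp (t * h x) * Real.exp (t * (h y - (h x - f x)))) * D := by ring
            rw [this, ← mul_assoc, ← Real.exp_add, ← Real.exp_add]
            ring_nf
      _ ≤ Real.exp (t * h x) * D * ((2 * (k:ℝ) - 1) * Real.exp (16 * t^2)) :=
            mul_le_mul_of_nonneg_left (exp_step hk h hh t ht x _ (hfh x)) (by positivity)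
      _ = _ := by rw [hD, pow_succ]; ring

/-- all reduced words of length `n+1` -/
def AW (k n : ℕ) : Finset (List (Letter k)) := Finset.univ.biUnion (RW n)

theorem AW_sum {k : ℕ} (n : ℕ) (g : List (Letter k) → ℝ) :
    ∑ w ∈ AW k n, g w = ∑ x, ∑ w ∈ RW n x, g w := by
  rw [AW, Finset.sum_biUnion]
  intro y _ z _ hyz
  exact RW_disj n y z hyz

theorem AW_mem {k : ℕ} (n : ℕ) (w : List (Letter k)) :
    w ∈ AW k n ↔ FreeGroup.IsReduced w ∧ w.length = n + 1 := by
  simp only [AW, Finset.mem_biUnion, Finset.mem_univ, true_and, RW_mem]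
  constructor
  · rintro ⟨x, h1, h2, -⟩; exact ⟨h1, h2⟩
  · rintro ⟨h1, h2⟩
    match w, h1, h2 with
    | z :: v, h1, h2 => exact ⟨z, h1, h2, rfl⟩

theorem AW_card {k : ℕ} (hk : 2 ≤ k) (n : ℕ) :
    ((AW k n).card : ℝ) = 2 * (k:ℝ) * (2 * (k:ℝ) - 1) ^ n := by
  have := AW_sum (k := k) n (fun _ => 1)
  simp only [Finset.sum_const, nsmul_eq_mul, mul_one, RW_card hk] at this
  rw [this]
  congr 1
  simp; ring

open Classical in
theorem ncard_words {k : ℕ} (n : ℕ) (P : List (Letter k) → Prop) :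
    {g : FG k | wordLength g = n + 1 ∧ P (FreeGroup.toWord g)}.ncard
      = ((AW k n).filter P).card := by
  rw [← Set.ncard_coe_finset, ← Set.ncard_image_of_injective _ FreeGroup.toWord_injective]
  congr 1
  ext w
  simp only [Set.mem_image, Set.mem_ofPred_eq, Finset.coe_filter, AW_mem, wordLength]
  constructor
  · rintro ⟨g, ⟨h1, h2⟩, rfl⟩
    exact ⟨⟨FreeGroup.isReduced_toWord, h1⟩, h2⟩
  · rintro ⟨⟨h1, h2⟩, h3⟩
    have : (FreeGroup.mk w).toWord = w := by
      rw [FreeGroup.toWord_mk]; exact h1.reduce_eq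
    exact ⟨FreeGroup.mk w, by rw [this]; exact ⟨h2, h3⟩, this⟩

theorem tail_bound {k : ℕ} (hk : 2 ≤ k) (f h : Letter k → ℝ) (hh : ∀ x, |h x| ≤ 2)
    (hf : ∀ x, |f x| ≤ 1)
    (hfh : ∀ x, (2 * (k:ℝ) - 1) * (h x - f x) = ∑ y ∈ Finset.univ.erase (linv x), h y)
    (t : ℝ) (ht : |t| ≤ 1/4) (n : ℕ) (c : ℝ) (B : Finset (List (Letter k))) (hB : B ⊆ AW k n)
    (hBc : ∀ w ∈ B, c ≤ t * (w.map f).sum) :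
    (B.card : ℝ) ≤ (AW k n).card * (Real.exp 2 * Real.exp (16 * t^2 * n - c)) := by
  have hk' : (2:ℝ) ≤ k := by exact_mod_cast hk
  have hq : 0 < 2 * (k:ℝ) - 1 := by linarith
  have h1 : (B.card : ℝ) ≤ ∑ w ∈ AW k n, Real.exp (t * (w.map f).sum) * Real.exp (-c) := by
    calc (B.card : ℝ) = ∑ w ∈ B, 1 := by simp
      _ ≤ ∑ w ∈ B, Real.exp (t * (w.map f).sum) * Real.exp (-c) := by
          refine Finset.sum_le_sum fun w hw => ?_
          rw [← Real.exp_add]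
          apply Real.one_le_exp
          have := hBc w hw
          linarith
      _ ≤ _ := Finset.sum_le_sum_of_subset_of_nonneg hB fun w _ _ => by positivity
  refine h1.trans ?_
  rw [← Finset.sum_mul, AW_sum, AW_card hk]
  have h2 : ∀ x : Letter k, ∑ w ∈ RW n x, Real.exp (t * (w.map f).sum) ≤
      Real.exp 2 * ((2 * (k:ℝ) - 1) * Real.exp (16 * t^2)) ^ n := by
    intro x
    refine (mgf_bound hk f h hh hf hfh t ht n x).trans ?_
    rw [← mul_assoc]
    apply mul_le_mul_of_nonneg_right _ (by positivity)
    rw [← Real.exp_add]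
    apply Real.exp_le_exp.2
    have h1 : |t * h x| ≤ 1 := by
      rw [abs_mul]
      nlinarith [abs_nonneg t, abs_nonneg (h x), hh x]
    have := (abs_le.1 h1).2
    linarith
  refine (mul_le_mul_of_nonneg_right (Finset.sum_le_sum fun x _ => h2 x)
    (Real.exp_pos _).le).trans (le_of_eq ?_)
  rw [sub_eq_add_neg (16 * t^2 * (n:ℝ)) c, Real.exp_add, mul_pow, ← Real.exp_nat_mul,
    Finset.sum_const, nsmul_eq_mul]
  have hcard : ((Finset.univ : Finset (Letter k)).card : ℝ) = 2 * (k:ℝ) := by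
    simp; ring
  rw [hcard]
  ring_nf

/-- centred indicator -/
noncomputable def fF {k : ℕ} (a : Letter k) (x : Letter k) : ℝ :=
  (if x = a then 1 else 0) - 1 / (2 * (k:ℝ))

/-- solution of the Poisson equation -/
noncomputable def hF {k : ℕ} (a : Letter k) (x : Letter k) : ℝ :=
  (if x = a then (2*(k:ℝ)-1)^2 / ((2*(k:ℝ)-1)^2 - 1) else 0) -
    (if x = linv a then (2*(k:ℝ)-1) / ((2*(k:ℝ)-1)^2 - 1) else 0)

theorem linv_linv {k : ℕ} (x : Letter k) : linv (linv x) = x := by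
  simp [linv]

theorem linv_ne {k : ℕ} (x : Letter k) : linv x ≠ x := by
  intro h
  have := congrArg Prod.snd h
  simp [linv] at this

theorem poisson {k : ℕ} (hk : 2 ≤ k) (a x : Letter k) :
    (2 * (k:ℝ) - 1) * (hF a x - fF a x) = ∑ y ∈ Finset.univ.erase (linv x), hF a y := by
  have hk' : (2:ℝ) ≤ k := by exact_mod_cast hk
  have hd : (2*(k:ℝ)-1)^2 - 1 ≠ 0 := by nlinarith
  have hk0 : (k:ℝ) ≠ 0 := by linarith
  have h1 : ∑ y ∈ Finset.univ.erase (linv x), hF a y = (∑ y, hF a y) - hF a (linv x) := by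
    rw [← Finset.add_sum_erase _ _ (Finset.mem_univ (linv x))]; ring
  have h2 : ∑ y, hF a y = (2*(k:ℝ)-1)^2 / ((2*(k:ℝ)-1)^2 - 1) -
      (2*(k:ℝ)-1) / ((2*(k:ℝ)-1)^2 - 1) := by
    simp [hF, Finset.sum_sub_distrib]
  rw [h1, h2]
  have e1 : linv x = a ↔ x = linv a := by
    constructor
    · rintro rfl; rw [linv_linv]
    · rintro rfl; rw [linv_linv]
  have e2 : linv x = linv a ↔ x = a := by
    constructor
    · intro h; rw [← linv_linv x, h, linv_linv]
    · rintro rfl; rfl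
  simp only [hF, fF, e1, e2]
  by_cases ha : x = a
  · subst ha
    simp only [(linv_ne x).symm, if_true, if_false]
    field_simp
    ring
  · by_cases hb : x = linv a
    · simp only [hb, linv_ne, if_true, if_false]
      field_simp
      ring
    · simp only [ha, hb, if_false]
      field_simp
      ring

theorem fF_bd {k : ℕ} (hk : 2 ≤ k) (a x : Letter k) : |fF a x| ≤ 1 := by
  have hk' : (2:ℝ) ≤ k := by exact_mod_cast hk
  have h1 : 1 / (2 * (k:ℝ)) ≤ 1 := by rw [div_le_one] <;> linarith
  have h0 : 0 ≤ 1 / (2 * (k:ℝ)) := by positivity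
  unfold fF
  rw [abs_le]
  split_ifs <;> constructor <;> linarith

theorem hF_bd {k : ℕ} (hk : 2 ≤ k) (a x : Letter k) : |hF a x| ≤ 2 := by
  have hk' : (2:ℝ) ≤ k := by exact_mod_cast hk
  have hd : 0 < (2*(k:ℝ)-1)^2 - 1 := by nlinarith
  have h1 : (2*(k:ℝ)-1)^2 / ((2*(k:ℝ)-1)^2 - 1) ≤ 2 := by
    rw [div_le_iff₀ hd]; nlinarith
  have h2 : (2*(k:ℝ)-1) / ((2*(k:ℝ)-1)^2 - 1) ≤ 1 := by
    rw [div_le_iff₀ hd]; nlinarith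
  have h3 : 0 ≤ (2*(k:ℝ)-1)^2 / ((2*(k:ℝ)-1)^2 - 1) := by positivity
  have h4 : 0 ≤ (2*(k:ℝ)-1) / ((2*(k:ℝ)-1)^2 - 1) := div_nonneg (by linarith) hd.le
  unfold hF
  rw [abs_le]
  split_ifs <;> constructor <;> linarith

theorem fF_sum {k : ℕ} (a : Letter k) (w : List (Letter k)) :
    (w.map (fF a)).sum = (w.count a : ℝ) - w.length * (1 / (2 * (k:ℝ))) := by
  induction w with
  | nil => simp
  | cons x w ih =>
    rw [List.map_cons, List.sum_cons, ih, List.count_cons, fF]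
    simp only [beq_iff_eq, List.length_cons]
    push_cast
    ring

/-- for any `ε > 0` and any letter `a ∈ Σ`, the proportion of freely
reduced words of length `n` with `w_a/n ∈ (1/(2k) − ε, 1/(2k) + ε)` tends to `1`
exponentially fast. -/
theorem letter_frequency_generic (k : ℕ) (hk : 2 ≤ k) (ε : ℝ) (hε : 0 < ε)
    (a : Letter k) :
    ∃ K : ℝ, 0 < K ∧ ∃ σ : ℝ, 0 < σ ∧ σ < 1 ∧ ∀ n : ℕ,
      |1 - ({g : FG k | wordLength g = n ∧
          1 / (2 * (k : ℝ)) - ε < ((FreeGroup.toWord g).count a : ℝ) / n ∧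
          ((FreeGroup.toWord g).count a : ℝ) / n < 1 / (2 * (k : ℝ)) + ε}.ncard : ℝ) /
        (gammaC (Set.univ : Set (FG k)) n : ℝ)| ≤ K * σ ^ n := by
  classical
  set s : ℝ := min (1/4) (ε/32) with hs
  have hs0 : 0 < s := by positivity
  have hs1 : s ≤ 1/4 := min_le_left _ _
  have hs2 : s ≤ ε/32 := min_le_right _ _
  have he2 : 1 ≤ Real.exp 2 := Real.one_le_exp (by norm_num)
  refine ⟨2 * Real.exp 2, by positivity, Real.exp (-(s * ε / 2)), Real.exp_pos _,
    Real.exp_lt_one_iff.2 (by have := mul_pos hs0 hε; linarith), ?_⟩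
  intro n
  cases n with
  | zero =>
    have hfin : {g ∈ (Set.univ : Set (FG k)) | wordLength g = 0}.Finite := by
      apply Set.Finite.subset (Set.finite_singleton (1 : FG k))
      rintro g ⟨-, hg⟩
      exact FreeGroup.toWord_eq_nil_iff.1 (List.length_eq_zero_iff.1 hg)
    have hle : {g : FG k | wordLength g = 0 ∧
          1 / (2 * (k : ℝ)) - ε < ((FreeGroup.toWord g).count a : ℝ) / (0:ℕ) ∧
          ((FreeGroup.toWord g).count a : ℝ) / (0:ℕ) < 1 / (2 * (k : ℝ)) + ε}.ncard ≤
          gammaC (Set.univ : Set (FG k)) 0 :=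
      Set.ncard_le_ncard (fun g hg => ⟨trivial, hg.1⟩) hfin
    have h1 := div_le_one_of_le₀ (Nat.cast_le (α := ℝ).2 hle) (Nat.cast_nonneg _)
    have h0 := div_nonneg (Nat.cast_nonneg (α := ℝ) {g : FG k | wordLength g = 0 ∧
          1 / (2 * (k : ℝ)) - ε < ((FreeGroup.toWord g).count a : ℝ) / (0:ℕ) ∧
          ((FreeGroup.toWord g).count a : ℝ) / (0:ℕ) < 1 / (2 * (k : ℝ)) + ε}.ncard)
          (Nat.cast_nonneg (α := ℝ) (gammaC (Set.univ : Set (FG k)) 0))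
    rw [pow_zero, mul_one, abs_le]
    constructor <;> linarith
  | succ m =>
    have hk' : (2:ℝ) ≤ k := by exact_mod_cast hk
    have hq : 0 < 2 * (k:ℝ) - 1 := by linarith
    have hT : gammaC (Set.univ : Set (FG k)) (m+1) = (AW k m).card := by
      have := ncard_words (k := k) m (fun _ => True)
      simpa [gammaC] using this
    rw [hT, ncard_words m (fun w => 1 / (2 * (k : ℝ)) - ε < (w.count a : ℝ) / (m+1 : ℕ) ∧
          (w.count a : ℝ) / (m+1 : ℕ) < 1 / (2 * (k : ℝ)) + ε)]
    have hTpos : (0:ℝ) < (AW k m).card := by rw [AW_card hk]; positivity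
    set P : List (Letter k) → Prop := fun w => 1 / (2 * (k : ℝ)) - ε < (w.count a : ℝ) / (m+1 : ℕ) ∧
          (w.count a : ℝ) / (m+1 : ℕ) < 1 / (2 * (k : ℝ)) + ε with hP
    have hsplit : (((AW k m).filter P).card : ℝ) + ((AW k m).filter (fun w => ¬ P w)).card
        = (AW k m).card := by
      exact_mod_cast Finset.card_filter_add_card_filter_not (s := AW k m) P
    have hm : (0:ℝ) < ((m+1 : ℕ) : ℝ) := by positivity
    set N : ℝ := ((m+1 : ℕ) : ℝ) with hN
    set B1 := (AW k m).filter (fun w => 1 / (2 * (k : ℝ)) + ε ≤ (w.count a : ℝ) / N) with hB1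
    set B2 := (AW k m).filter (fun w => (w.count a : ℝ) / N ≤ 1 / (2 * (k : ℝ)) - ε) with hB2
    have hsub : ((AW k m).filter (fun w => ¬ P w)) ⊆ B1 ∪ B2 := by
      intro w hw
      simp only [hP, Finset.mem_filter, not_and_or, not_lt] at hw
      simp only [hB1, hB2, Finset.mem_union, Finset.mem_filter]
      tauto
    have hbad : (((AW k m).filter (fun w => ¬ P w)).card : ℝ) ≤ B1.card + B2.card := by
      exact_mod_cast (Finset.card_le_card hsub).trans (Finset.card_union_le _ _)
    have hlen : ∀ w ∈ AW k m, ((w.length : ℕ) : ℝ) = N := fun w hw => by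
      rw [((AW_mem m w).1 hw).2]
    have b1 := tail_bound hk (fF a) (hF a) (hF_bd hk a) (fF_bd hk a) (poisson hk a) s
      (by rw [abs_of_pos hs0]; exact hs1) m (s * (ε * N)) B1 (Finset.filter_subset _ _) (by
        intro w hw
        rw [hB1, Finset.mem_filter, le_div_iff₀ hm] at hw
        rw [fF_sum, hlen w hw.1]
        apply mul_le_mul_of_nonneg_left _ hs0.le
        linarith [hw.2])
    have b2 := tail_bound hk (fF a) (hF a) (hF_bd hk a) (fF_bd hk a) (poisson hk a) (-s)
      (by rw [abs_neg, abs_of_pos hs0]; exact hs1) m (s * (ε * N)) B2 (Finset.filter_subset _ _) (by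
        intro w hw
        rw [hB2, Finset.mem_filter, div_le_iff₀ hm] at hw
        rw [fF_sum, hlen w hw.1, neg_mul_comm]
        apply mul_le_mul_of_nonneg_left _ hs0.le
        linarith [hw.2])
    rw [neg_sq] at b2
    have hexp : Real.exp (16 * s^2 * m - s * (ε * N)) ≤ Real.exp (-(s * ε / 2)) ^ (m+1) := by
      rw [← Real.exp_nat_mul]
      apply Real.exp_le_exp.2
      have hmN : (m:ℝ) ≤ N := by rw [hN]; push_cast; linarith
      have h1 : 16 * s^2 * m ≤ 16 * s^2 * N := mul_le_mul_of_nonneg_left hmN (by positivity)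
      have h2 : s * N * (16 * s) ≤ s * N * (ε / 2) :=
        mul_le_mul_of_nonneg_left (by linarith) (by positivity)
      rw [← hN]
      nlinarith
    have hfinal : (((AW k m).filter (fun w => ¬ P w)).card : ℝ) ≤
        (2 * Real.exp 2 * Real.exp (-(s * ε / 2)) ^ (m+1)) * (AW k m).card := by
      have h3 : ((AW k m).card : ℝ) * (Real.exp 2 * Real.exp (16 * s^2 * m - s * (ε * N))) ≤
          (AW k m).card * (Real.exp 2 * Real.exp (-(s * ε / 2)) ^ (m+1)) := by gcongr
      linarith
    have hr : 1 - (((AW k m).filter P).card : ℝ) / (AW k m).card =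
        (((AW k m).filter (fun w => ¬ P w)).card : ℝ) / (AW k m).card := by
      rw [← hsplit]
      rw [← hsplit] at hTpos
      field_simp
      ring
    have hmain : |1 - (((AW k m).filter P).card : ℝ) / (AW k m).card| ≤
        2 * Real.exp 2 * Real.exp (-(s * ε / 2)) ^ (m+1) := by
      rw [hr, abs_of_nonneg (by positivity), div_le_iff₀ hTpos]
      exact hfinal
    convert hmain
end

section
/- Let τ be a nontrivial relabeling automorphism of F_k and let B(τ) be the set of all cyclically reduced words w such that τ(w) is conjugate to w in F_k. Then B(τ) is exponentially negligible in C. -/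
namespace RelabelAux
open FreeGroup

def Cyc {k : ℕ} (L : List (Letter k)) : Prop := IsReduced (L ++ L)

lemma cyc_rot {k : ℕ} (y : Letter k) (u : List (Letter k)) :
    Cyc (y :: u) ↔ Cyc (u ++ [y]) := by
  unfold Cyc
  constructor
  · intro h
    have h1 : IsReduced (u ++ ([y] ++ u)) := h.infix ⟨[y], [], by simp⟩
    have h2 : IsReduced (([y] ++ u) ++ [y]) := h.infix ⟨[], u, by simp⟩
    have := h1.append_overlap h2 (by simp)
    simpa using this
  · intro h
    have h1 : IsReduced ([y] ++ (u ++ [y])) := h.infix ⟨u, [], by simp⟩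
    have h2 : IsReduced ((u ++ [y]) ++ u) := h.infix ⟨[], [y], by simp⟩
    have := h1.append_overlap h2 (by simp)
    simpa using this

lemma Cyc.red {k : ℕ} {L : List (Letter k)} (h : Cyc L) : IsReduced L :=
  IsReduced.infix h ⟨[], L, by simp⟩

lemma mk_inv_single {k : ℕ} (x : Letter k) : (mk [linv x] : FG k) = (mk [x])⁻¹ := by
  simp [linv, inv_mk, invRev]

lemma rel_iff {k : ℕ} (a b : Letter k) : (a.1 = b.1 → a.2 = b.2) ↔ b ≠ linv a := by
  rcases a with ⟨i, s⟩; rcases b with ⟨j, t⟩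
  cases s <;> cases t <;> simp [linv, eq_comm]

lemma linv_linv {k : ℕ} (a : Letter k) : linv (linv a) = a := by simp [linv]

lemma isReduced_invRev {k : ℕ} {L : List (Letter k)} (h : IsReduced L) :
    IsReduced (invRev L) := by
  rw [isReduced_iff_reduce_eq] at *
  rw [reduce_invRev, h]

lemma isReduced_append {k : ℕ} {L M : List (Letter k)} (h : IsReduced L) (h' : IsReduced M)
    (hh : ∀ a ∈ L.getLast?, ∀ b ∈ M.head?, b ≠ linv a) : IsReduced (L ++ M) := by
  unfold FreeGroup.IsReduced at *
  rw [List.isChain_append]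
  refine ⟨h, h', fun a ha b hb => (rel_iff a b).2 (hh a ha b hb)⟩

lemma conj_rot {k : ℕ} (L : List (Letter k)) : IsReduced L → ∀ u v : List (Letter k),
    Cyc u → Cyc v → (mk v : FG k) = mk L * mk u * (mk L)⁻¹ → v ~r u := by
  induction L using List.reverseRecOn with
  | nil =>
    intro _ u v hu hv h
    have h1 : (mk v : FG k) = mk u := by
      rw [h, ← one_eq_mk]; group
    have := reduce.sound h1
    rw [hu.red.reduce_eq, hv.red.reduce_eq] at this
    rw [this]
  | append_singleton L x ih =>
    intro hL u v hu hv h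
    have hL' : IsReduced L := hL.infix ⟨[], [x], by simp⟩
    have hm : (mk (L ++ [x]) : FG k) = mk L * mk [x] := by simp [mul_mk]
    rw [hm] at h
    by_cases hu0 : u = []
    · subst hu0
      have h1 : (mk v : FG k) = mk [] := by
        rw [h, ← one_eq_mk]; group
      have := reduce.sound h1
      rw [hu.red.reduce_eq, hv.red.reduce_eq] at this
      rw [this]
    by_cases hc1 : ∃ u', u = linv x :: u'
    · obtain ⟨u', rfl⟩ := hc1
      refine (ih hL' (u' ++ [linv x]) v ((cyc_rot _ _).1 hu) hv ?_).trans ?_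
      · rw [h]
        have e1 : (mk (linv x :: u') : FG k) = mk [linv x] * mk u' := by simp [mul_mk]
        have e2 : (mk (u' ++ [linv x]) : FG k) = mk u' * mk [linv x] := by simp [mul_mk]
        rw [e1, e2, mk_inv_single]; group
      · exact List.IsRotated.symm ⟨1, by simp⟩
    by_cases hc2 : ∃ u', u = u' ++ [x]
    · obtain ⟨u', rfl⟩ := hc2
      refine (ih hL' (x :: u') v ((cyc_rot _ _).2 hu) hv ?_).trans ?_
      · rw [h]
        have e1 : (mk (x :: u') : FG k) = mk [x] * mk u' := by simp [mul_mk]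
        have e2 : (mk (u' ++ [x]) : FG k) = mk u' * mk [x] := by simp [mul_mk]
        rw [e1, e2]; group
      · exact ⟨1, by simp⟩
    exfalso
    have r1 : IsReduced ((L ++ [x]) ++ u) := by
      refine isReduced_append hL hu.red ?_
      intro a ha b hb hab
      have hax : a = x := by simpa [eq_comm] using ha
      subst hax hab
      cases u with
      | nil => simp at hb
      | cons c u' =>
        have : c = linv a := by simpa using hb
        exact hc1 ⟨u', by rw [this]⟩
    have r2 : IsReduced (u ++ invRev (L ++ [x])) := by
      refine isReduced_append hu.red (isReduced_invRev hL) ?_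
      intro a ha b hb hab
      have hbx : b = linv x := by simpa [eq_comm, invRev, linv] using hb
      have hax : a = x := by rw [← linv_linv a, ← hab, hbx, linv_linv]
      subst hax
      have := List.mem_getLast?_eq_getLast ha
      obtain ⟨h', h''⟩ := this
      exact hc2 ⟨u.dropLast, by rw [h'', List.dropLast_append_getLast h']⟩
    have r3 := r1.append_overlap r2 hu0
    have hv' : v = (L ++ [x]) ++ u ++ invRev (L ++ [x]) := by
      rw [← hv.red.reduce_eq, ← r3.reduce_eq]
      apply reduce.sound
      rw [h, ← hm, inv_mk, mul_mk, mul_mk]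
    obtain ⟨a, M, haM⟩ : ∃ a M, L ++ [x] = a :: M := by
      cases L with
      | nil => exact ⟨x, [], rfl⟩
      | cons a L => exact ⟨a, L ++ [x], rfl⟩
    rw [haM] at hv'
    have r4 : IsReduced [linv a, a] := by
      refine IsReduced.infix hv ?_
      refine ⟨a :: M ++ u ++ invRev M, M ++ u ++ invRev (a :: M), ?_⟩
      rw [hv']
      simp [invRev, linv]
    rw [isReduced_cons_cons, rel_iff, linv_linv] at r4
    exact r4.1 rfl

lemma cyc_iff {k : ℕ} (g : FG k) : g ∈ Cset k ↔ Cyc g.toWord := by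
  unfold Cset _root_.IsCyclicallyReduced CyclicallyReducedWord Cyc
  rw [isReduced_iff_reduce_eq]; rfl

lemma conj_rot' {k : ℕ} {u v : FG k} (hu : u ∈ Cset k) (hv : v ∈ Cset k) (h : IsConj u v) :
    v.toWord ~r u.toWord := by
  obtain ⟨c, hc⟩ := isConj_iff.1 h
  refine conj_rot c.toWord isReduced_toWord _ _ ((cyc_iff _).1 hu) ((cyc_iff _).1 hv) ?_
  simp [mk_toWord, hc]

/-- structure of relabelings -/
lemma exists_perm {k : ℕ} (τ : MulAut (FG k)) (hτ : IsRelabeling τ) (hne : τ ≠ 1) :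
    ∃ t : Equiv.Perm (Letter k), (∀ x, t (linv x) = linv (t x)) ∧
      (∀ L : List (Letter k), τ (mk L) = mk (L.map t)) ∧ ∃ x, t x ≠ x := by
  have h1 : ∀ x : Letter k, ∃ y : Letter k, τ (mk [x]) = mk [y] := by
    rintro ⟨i, b⟩
    have hm : (mk [(i, b)] : FG k) ∈ letterSet k := by
      refine ⟨i, ?_⟩
      cases b
      · right; simp [of, inv_mk, invRev]
      · left; rfl
    have : τ (mk [(i, b)]) ∈ letterSet k := by
      rw [← hτ]; exact ⟨_, hm, rfl⟩
    obtain ⟨j, hj | hj⟩ := this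
    · exact ⟨(j, true), hj⟩
    · exact ⟨(j, false), by rw [hj]; simp [of, inv_mk, invRev]⟩
  choose f hf using h1
  have hmk : ∀ x y : Letter k, (mk [x] : FG k) = mk [y] → x = y := by
    intro x y h
    have := reduce.sound h
    simpa [reduce_singleton] using this
  have hinj : Function.Injective f := by
    intro x y h
    apply hmk
    apply τ.injective
    rw [hf, hf, h]
  have hlinv : ∀ x, f (linv x) = linv (f x) := by
    intro x
    apply hmk
    rw [← hf, mk_inv_single, mk_inv_single, _root_.map_inv, hf]
  let t : Equiv.Perm (Letter k) := Equiv.ofBijective f (Finite.injective_iff_bijective.1 hinj)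
  have ht : ∀ x, t x = f x := fun x => rfl
  refine ⟨t, hlinv, ?_, ?_⟩
  · intro L
    induction L with
    | nil => simp [← one_eq_mk]
    | cons x L ih =>
      have e1 : (mk (x :: L) : FG k) = mk [x] * mk L := by simp [mul_mk]
      rw [e1, _root_.map_mul, ih, hf, mul_mk]; rfl
  · by_contra hcon
    push Not at hcon
    apply hne
    have : (τ : FG k →* FG k) = MonoidHom.id _ := by
      apply FreeGroup.ext_hom
      intro i
      have := hf (i, true)
      rw [← ht, hcon] at this
      exact this
    ext g
    exact congrArg (fun φ : FG k →* FG k => φ g) this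

lemma map_red {k : ℕ} (t : Equiv.Perm (Letter k)) (ht : ∀ x, t (linv x) = linv (t x))
    {L : List (Letter k)} (h : IsReduced L) : IsReduced (L.map t) := by
  unfold FreeGroup.IsReduced at *
  rw [List.isChain_map]
  refine h.imp ?_
  intro a b hab
  rw [rel_iff] at *
  rw [← ht]
  exact fun h => hab (t.injective h)

/-- The key combinatorial consequence. -/
lemma key {k : ℕ} (τ : MulAut (FG k)) (t : Equiv.Perm (Letter k))
    (ht : ∀ x, t (linv x) = linv (t x)) (ht' : ∀ L : List (Letter k), τ (mk L) = mk (L.map t))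
    (w : FG k) (hw : w ∈ Cset k) (hc : IsConj (τ w) w) :
    w.toWord.map t = w.toWord ∨ ∃ s, 1 ≤ s ∧ s ≤ w.toWord.length / 2 ∧
      (w.toWord.map t = w.toWord.rotate s ∨ w.toWord.map t.symm = w.toWord.rotate s) := by
  have hw' := (cyc_iff _).1 hw
  have h1 : (τ w).toWord = w.toWord.map t := by
    conv_lhs => rw [← mk_toWord (x := w), ht', toWord_mk]
    exact (map_red t ht hw'.red).reduce_eq
  have hτw : τ w ∈ Cset k := by
    rw [cyc_iff, h1, Cyc, ← List.map_append]
    exact map_red t ht hw'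
  have hr := conj_rot' hw hτw hc.symm
  rw [h1] at hr
  obtain ⟨s, hsle, hs⟩ := (List.isRotated_iff_mod.1 hr.symm)
  set W := w.toWord with hW
  rcases Nat.eq_zero_or_pos s with rfl | hpos
  · left; simpa using hs.symm
  by_cases hsl : s = W.length
  · left; rw [hsl, List.rotate_length] at hs; exact hs.symm
  right
  by_cases h2 : s ≤ W.length / 2
  · exact ⟨s, hpos, h2, Or.inl hs.symm⟩
  · refine ⟨W.length - s, by omega, by omega, Or.inr ?_⟩
    have h3 : (W.map t.symm).rotate s = W := by
      rw [← List.map_rotate, hs]; simp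
    conv_rhs => rw [← h3]
    have h4 : (W.map t.symm).length = W.length := by simp
    rw [List.rotate_rotate, List.length_rotate, h4, Nat.add_sub_cancel' hsle]
    conv_rhs => rw [← h4]
    rw [List.rotate_length]

/-- Counting words determined by a prefix with letters in `T`. -/
lemma count_le {α : Type*} [Fintype α] [DecidableEq α] (x0 : α) (T : Finset α) (s : ℕ)
    (A : Set (List α)) (hlen : ∀ w ∈ A, s ≤ w.length) (hT : ∀ w ∈ A, ∀ x ∈ w, x ∈ T)
    (hdet : ∀ w ∈ A, ∀ w' ∈ A, w.take s = w'.take s → w = w') :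
    A.Finite ∧ A.ncard ≤ T.card ^ s := by
  classical
  let f : List α → (Fin s → α) := fun w i => w.getD i x0
  have hinj : Set.InjOn f A := by
    intro w hw w' hw' h
    apply hdet w hw w' hw'
    have h1 := hlen w hw
    have h2 := hlen w' hw'
    apply List.ext_getElem (by simp; omega)
    intro i hi hi'
    have his : i < s := by simp at hi; omega
    have := congrFun h ⟨i, his⟩
    simp only [f] at this
    rw [List.getD_eq_getElem _ _ (by omega), List.getD_eq_getElem _ _ (by omega)] at this
    simpa using this
  have hmaps : ∀ w ∈ A, f w ∈ ((Fintype.piFinset (fun _ : Fin s => T) : Finset _) : Set (Fin s → α)) := by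
    intro w hw
    simp only [Finset.mem_coe, Fintype.mem_piFinset]
    intro i
    have h1 := hlen w hw
    have : f w i = w[(i : ℕ)]'(by omega) := List.getD_eq_getElem _ _ _
    rw [this]
    exact hT w hw _ (List.getElem_mem _)
  refine ⟨Set.Finite.of_injOn (f := f) hmaps hinj (Finset.finite_toSet _), ?_⟩
  have := Set.ncard_le_ncard_of_injOn f hmaps hinj (Finset.finite_toSet _)
  rwa [Set.ncard_coe_finset, Fintype.card_piFinset_const] at this

lemma count_rot {k : ℕ} (x0 : Letter k) (e : Equiv.Perm (Letter k)) (n s : ℕ) (hs : 1 ≤ s)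
    (hsn : s ≤ n) :
    {w : List (Letter k) | w.length = n ∧ w.map e = w.rotate s}.Finite ∧
    {w : List (Letter k) | w.length = n ∧ w.map e = w.rotate s}.ncard ≤ (2 * k) ^ s := by
  have := count_le x0 Finset.univ s {w : List (Letter k) | w.length = n ∧ w.map e = w.rotate s}
    (fun w hw => by rw [hw.1]; exact hsn) (fun _ _ _ _ => Finset.mem_univ _) ?_
  · simpa [mul_comm] using this
  rintro w ⟨hw, hw2⟩ w' ⟨hw', hw2'⟩ h
  have step : ∀ v : List (Letter k), v.length = n → v.map e = v.rotate s →
      ∀ i (h : i < v.length) (h' : i - s < v.length), s ≤ i → v[i] = e (v[i - s]) := by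
    intro v hv hv2 i h h' hsi
    have h1 : (v.map e)[i - s]'(by simpa using h') = (v.rotate s)[i - s]'(by simpa using h') := by
      simp only [hv2]
    rw [List.getElem_map, List.getElem_rotate] at h1
    rw [h1]
    congr 1
    rw [Nat.sub_add_cancel hsi, Nat.mod_eq_of_lt h]
  have main : ∀ i (h : i < w.length) (h' : i < w'.length), w[i] = w'[i] := by
    intro i
    induction i using Nat.strong_induction_on with
    | _ i ih =>
      intro h1 h2
      by_cases his : i < s
      · have h3 : (w.take s)[i]'(by simp; omega) = (w'.take s)[i]'(by simp; omega) := by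
          simp only [h]
        simpa using h3
      · rw [step w hw hw2 i h1 (by omega) (by omega), step w' hw' hw2' i h2 (by omega) (by omega),
          ih (i - s) (by omega) (by omega) (by omega)]
  exact List.ext_getElem (by omega) main

lemma count_fix {k : ℕ} (t : Equiv.Perm (Letter k)) (ht : ∀ x, t (linv x) = linv (t x))
    (x0 : Letter k) (hx0 : t x0 ≠ x0) (n : ℕ) :
    {w : List (Letter k) | w.length = n ∧ w.map t = w}.Finite ∧
    {w : List (Letter k) | w.length = n ∧ w.map t = w}.ncard ≤ (2 * k - 2) ^ n := by
  classical
  have hne : x0 ≠ linv x0 := by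
    intro h
    have := congrArg Prod.snd h
    simp [linv] at this
  have := count_le x0 (Finset.univ \ {x0, linv x0}) n
    {w : List (Letter k) | w.length = n ∧ w.map t = w}
    (fun w hw => by rw [hw.1]) ?_ ?_
  · rw [Finset.card_sdiff_of_subset (Finset.subset_univ _), Finset.card_pair hne] at this
    simpa [mul_comm] using this
  · rintro w ⟨-, hw⟩ x hx
    have hfix : t x = x := by
      have : w.map t = w.map id := by simpa using hw
      exact (List.map_inj_left.1 this) x hx
    simp only [Finset.mem_sdiff, Finset.mem_univ, true_and, Finset.mem_insert,
      Finset.mem_singleton, not_or]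
    refine ⟨fun h => hx0 (h ▸ hfix), fun h => ?_⟩
    rw [h, ht] at hfix
    apply hx0
    have := congrArg linv hfix
    rwa [linv_linv, linv_linv] at this
  · rintro w ⟨hw, -⟩ w' ⟨hw', -⟩ h
    rwa [List.take_of_length_le hw.le, List.take_of_length_le hw'.le] at h

lemma upper {k : ℕ} (hk : 2 ≤ k) (τ : MulAut (FG k)) (hτ : IsRelabeling τ) (hne : τ ≠ 1) (n : ℕ) :
    {w : FG k | (w ∈ Cset k ∧ IsConj (τ w) w) ∧ wordLength w = n}.ncard
      ≤ (4 * k + 1) * (2 * k - 2) ^ n := by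
  classical
  obtain ⟨t, ht, ht', x0, hx0⟩ := exists_perm τ hτ hne
  set B0 := {w : List (Letter k) | w.length = n ∧ w.map t = w} with hB0
  let Rt : Equiv.Perm (Letter k) → ℕ → Set (List (Letter k)) := fun e s =>
    {w : List (Letter k) | w.length = n ∧ w.map e = w.rotate s}
  let I := Finset.Icc 1 (n / 2)
  have f0 := count_fix t ht x0 hx0 n
  have fR : ∀ e, ∀ s ∈ I, (Rt e s).Finite ∧ (Rt e s).ncard ≤ (2 * k) ^ s := by
    intro e s hs
    have := Finset.mem_Icc.1 hs
    exact count_rot x0 e n s this.1 (by omega)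
  have fU : ∀ e, (⋃ s ∈ I, Rt e s).Finite ∧ (⋃ s ∈ I, Rt e s).ncard ≤ (2 * k) ^ (n / 2 + 1) := by
    intro e
    refine ⟨Set.Finite.biUnion I.finite_toSet fun s hs => (fR e s hs).1, ?_⟩
    refine (Finset.set_ncard_biUnion_le I (Rt e)).trans ?_
    refine (Finset.sum_le_sum fun s hs => (fR e s hs).2).trans ?_
    exact (Nat.geomSum_lt (by omega) (fun s hs => by have := Finset.mem_Icc.1 hs; omega)).le
  have h1 : {w : FG k | (w ∈ Cset k ∧ IsConj (τ w) w) ∧ wordLength w = n}.ncard ≤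
      (B0 ∪ ((⋃ s ∈ I, Rt t s) ∪ (⋃ s ∈ I, Rt t.symm s))).ncard := by
    refine Set.ncard_le_ncard_of_injOn toWord ?_ (toWord_injective.injOn)
      (f0.1.union ((fU t).1.union (fU t.symm).1))
    rintro w ⟨⟨hw, hc⟩, hl⟩
    have hl : w.toWord.length = n := hl
    rcases key τ t ht ht' w hw hc with h | ⟨s, hs1, hs2, h | h⟩
    · left; exact ⟨hl, h⟩
    · right; left
      simp only [Set.mem_iUnion]
      exact ⟨s, Finset.mem_Icc.2 ⟨hs1, by omega⟩, hl, h⟩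
    · right; right
      simp only [Set.mem_iUnion]
      exact ⟨s, Finset.mem_Icc.2 ⟨hs1, by omega⟩, hl, h⟩
  have h2 := Set.ncard_union_le B0 ((⋃ s ∈ I, Rt t s) ∪ (⋃ s ∈ I, Rt t.symm s))
  have h3 := Set.ncard_union_le (⋃ s ∈ I, Rt t s) (⋃ s ∈ I, Rt t.symm s)
  have h4 : (2 * k) ^ (n / 2 + 1) ≤ 2 * k * (2 * k - 2) ^ n := by
    rw [pow_succ, mul_comm]
    refine Nat.mul_le_mul_left _ ?_
    calc (2 * k) ^ (n / 2) ≤ ((2 * k - 2) ^ 2) ^ (n / 2) := by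
          gcongr
          obtain ⟨j, rfl⟩ := Nat.exists_eq_add_of_le hk
          have : 2 * (2 + j) - 2 = 2 + 2 * j := by omega
          rw [this]; nlinarith
      _ = (2 * k - 2) ^ (2 * (n / 2)) := by rw [pow_mul]
      _ ≤ (2 * k - 2) ^ n := Nat.pow_le_pow_right (by omega) (by omega)
  have h5 := (fU t).2
  have h6 := (fU t.symm).2
  have h7 := f0.2
  rw [← hB0] at h7
  have : (4 * k + 1) * (2 * k - 2) ^ n = (2 * k - 2) ^ n + (2 * k * (2 * k - 2) ^ n + 2 * k * (2 * k - 2) ^ n) := by ring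
  omega

lemma finite_len {k : ℕ} (S : Set (FG k)) (n : ℕ) : {w ∈ S | wordLength w ≤ n}.Finite := by
  refine Set.Finite.of_injOn (f := toWord) (t := {l : List (Letter k) | l.length ≤ n}) ?_
    toWord_injective.injOn (List.finite_length_le _ _)
  intro w hw
  exact hw.2

lemma upper_rho {k : ℕ} (hk : 2 ≤ k) (τ : MulAut (FG k)) (hτ : IsRelabeling τ) (hne : τ ≠ 1)
    (n : ℕ) : rhoC {w : FG k | w ∈ Cset k ∧ IsConj (τ w) w} n
      ≤ (4 * k + 1) * (2 * k - 2) ^ (n + 1) := by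
  unfold rhoC
  have h1 : {g ∈ {w : FG k | w ∈ Cset k ∧ IsConj (τ w) w} | wordLength g ≤ n} ⊆
      ⋃ j ∈ Finset.range (n + 1),
        {w : FG k | (w ∈ Cset k ∧ IsConj (τ w) w) ∧ wordLength w = j} := by
    rintro w ⟨hw, hl⟩
    simp only [Set.mem_iUnion]
    exact ⟨wordLength w, by simp; omega, hw, rfl⟩
  have hfin : (⋃ j ∈ Finset.range (n + 1),
        {w : FG k | (w ∈ Cset k ∧ IsConj (τ w) w) ∧ wordLength w = j}).Finite := by
    refine Set.Finite.biUnion (Finset.finite_toSet _) fun j _ => ?_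
    exact (finite_len {w : FG k | w ∈ Cset k ∧ IsConj (τ w) w} j).subset
      fun w hw => ⟨hw.1, hw.2.le⟩
  refine (Set.ncard_le_ncard h1 hfin).trans ?_
  refine (Finset.set_ncard_biUnion_le _ _).trans ?_
  refine (Finset.sum_le_sum fun j _ => upper hk τ hτ hne j).trans ?_
  rw [← Finset.mul_sum]
  gcongr
  exact (Nat.geomSum_lt (by omega) (fun s hs => by simpa using hs)).le

lemma lower_red {k : ℕ} (n : ℕ) :
    ∃ R : Finset (List (Letter k)), (∀ w ∈ R, w.length = n ∧ IsReduced w) ∧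
      (2 * k - 1) ^ n ≤ R.card := by
  classical
  induction n with
  | zero => exact ⟨{[]}, by simp, by simp⟩
  | succ n ih =>
    obtain ⟨R, hR, hc⟩ := ih
    let ok : List (Letter k) → Finset (Letter k) := fun w =>
      Finset.univ.filter fun x => ∀ b ∈ w.head?, b ≠ linv x
    have hok : ∀ w, 2 * k - 1 ≤ (ok w).card := by
      intro w
      cases w with
      | nil => simp [ok]; omega
      | cons b w =>
        have : Finset.univ.erase (linv b) ⊆ ok (b :: w) := by
          intro x hx
          simp only [ok, Finset.mem_filter, Finset.mem_univ, true_and]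
          intro c hc hcx
          have hcb : b = c := by simpa using hc
          subst hcb
          rw [Finset.mem_erase] at hx
          apply hx.1
          rw [hcx, linv_linv]
        have h := Finset.card_le_card this
        rw [Finset.card_erase_of_mem (Finset.mem_univ _)] at h
        simpa [mul_comm] using h
    refine ⟨(R.sigma ok).image (fun p => p.2 :: p.1), ?_, ?_⟩
    · intro w hw
      simp only [Finset.mem_image, Finset.mem_sigma] at hw
      obtain ⟨⟨v, x⟩, ⟨hv, hx⟩, rfl⟩ := hw
      have := hR v hv
      refine ⟨by simp [this.1], ?_⟩
      have h2 : IsReduced ([x] ++ v) := by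
        refine isReduced_append IsReduced.singleton this.2 ?_
        intro a ha b hb
        have hax : x = a := by simpa using ha
        subst hax
        simp only [ok, Finset.mem_filter] at hx
        exact hx.2 b hb
      exact h2
    · rw [Finset.card_image_of_injective, Finset.card_sigma]
      · calc (2 * k - 1) ^ (n + 1) = (2 * k - 1) ^ n * (2 * k - 1) := pow_succ _ _
          _ ≤ R.card * (2 * k - 1) := by gcongr
          _ = ∑ w ∈ R, (2 * k - 1) := by simp
          _ ≤ _ := Finset.sum_le_sum fun w _ => hok w
      · rintro ⟨v, x⟩ ⟨v', x'⟩ h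
        simp only [List.cons.injEq] at h
        obtain ⟨rfl, rfl⟩ := h
        rfl

lemma exists_ext {k : ℕ} (hk : 2 ≤ k) (w : List (Letter k)) (hw : IsReduced w) :
    ∃ x : Letter k, Cyc (x :: w) := by
  classical
  rcases w.eq_nil_or_concat with rfl | ⟨v, a, rfl⟩
  · exact ⟨(⟨0, by omega⟩, true), by simp [Cyc]⟩
  obtain ⟨b, hb⟩ : ∃ b, (v ++ [a]).head? = some b := by
    cases v <;> simp
  obtain ⟨x, hx⟩ : ∃ x : Letter k, x ∉ ({linv a, linv b} : Finset (Letter k)) := by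
    by_contra hcon
    push Not at hcon
    have h1 : (Finset.univ : Finset (Letter k)) ⊆ {linv a, linv b} := fun x _ => hcon x
    have h2 := Finset.card_le_card h1
    have h3 := Finset.card_le_two (a := linv a) (b := linv b)
    simp at h2
    omega
  simp only [Finset.mem_insert, Finset.mem_singleton, not_or] at hx
  have h1 : IsReduced ([x] ++ (v ++ [a])) := by
    refine isReduced_append IsReduced.singleton (by simpa using hw) ?_
    intro c hc d hd hdc
    have hcx : x = c := by simpa using hc
    have hdb : b = d := by rw [hb] at hd; simpa using hd
    apply hx.2
    rw [hdb, hdc, linv_linv, hcx]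
  refine ⟨x, ?_⟩
  have h2 : IsReduced (([x] ++ (v ++ [a])) ++ ([x] ++ (v ++ [a]))) := by
    refine isReduced_append h1 h1 ?_
    intro c hc d hd hdc
    have hca : c = a := by
      rw [← List.append_assoc, List.getLast?_concat] at hc
      simpa [eq_comm] using hc
    have hdx : x = d := by simpa using hd
    apply hx.1
    rw [hdx, hdc, hca]
  simpa [Cyc] using h2

lemma lower_rho {k : ℕ} (hk : 2 ≤ k) (n : ℕ) :
    (2 * k - 1) ^ n ≤ rhoC (Cset k) n * (2 * k - 1) := by
  classical
  cases n with
  | zero =>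
    have : 0 < rhoC (Cset k) 0 := by
      unfold rhoC
      rw [Set.ncard_pos (finite_len _ _)]
      refine ⟨1, ?_, ?_⟩
      · rw [cyc_iff]; simp [Cyc]
      · simp [wordLength]
    have h2 : 1 ≤ 2 * k - 1 := by omega
    simpa using Nat.mul_le_mul this h2
  | succ n =>
    obtain ⟨R, hR, hc⟩ := lower_red (k := k) n
    rw [pow_succ]
    gcongr
    refine hc.trans ?_
    haveI : Nonempty (Letter k) := ⟨(⟨0, by omega⟩, true)⟩
    choose! f hf using fun w (hw : IsReduced w) => exists_ext hk w hw
    have : R.card = (R : Set (List (Letter k))).ncard := (Set.ncard_coe_finset R).symm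
    rw [this]
    unfold rhoC
    have htw : ∀ w ∈ R, (mk (f w :: w) : FG k).toWord = f w :: w := by
      intro w hw
      rw [toWord_mk]
      exact (hf w (hR w hw).2).red.reduce_eq
    refine Set.ncard_le_ncard_of_injOn (fun w => (mk (f w :: w) : FG k)) ?_ ?_ (finite_len _ _)
    · intro w hw
      have hw : w ∈ R := hw
      refine ⟨?_, ?_⟩
      · rw [cyc_iff, htw w hw]; exact hf w (hR w hw).2
      · unfold wordLength
        rw [htw w hw]; simp [(hR w hw).1]
    · intro w hw w' hw' h
      have h := congrArg toWord h
      simp only [htw w hw, htw w' hw', List.cons.injEq] at h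
      exact h.2

end RelabelAux

/-- for a nontrivial relabeling automorphism `τ`, the set `B(τ)` of
cyclically reduced words `w` with `τ w` conjugate to `w` is exponentially negligible
in `C`. -/
theorem relabeling_fixed_conjugacy_negligible (k : ℕ) (hk : 2 ≤ k)
    (τ : MulAut (FG k)) (hτ : IsRelabeling τ) (hne : τ ≠ 1) :
    ExpNegligibleIn {w : FG k | w ∈ Cset k ∧ IsConj (τ w) w} (Cset k) := by
  classical
  set B := {w : FG k | w ∈ Cset k ∧ IsConj (τ w) w} with hB
  have hBC : B ⊆ Cset k := fun w hw => hw.1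
  refine ⟨Set.sdiff_subset, (4 * k + 1) * (2 * k - 2) * (2 * k - 1), ?_,
    (2 * k - 2) / (2 * k - 1), ?_, ?_, ?_⟩
  all_goals have hk' : (2 : ℝ) ≤ k := by exact_mod_cast hk
  all_goals have p1 : (0 : ℝ) < 2 * k - 2 := by linarith
  all_goals have p2 : (0 : ℝ) < 2 * k - 1 := by linarith
  · positivity
  · positivity
  · rw [div_lt_one p2]; linarith
  intro n
  have hsum : rhoC (Cset k \ B) n + rhoC B n = rhoC (Cset k) n := by
    unfold rhoC
    rw [← Set.ncard_union_eq _ (RelabelAux.finite_len _ _) (RelabelAux.finite_len _ _)]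
    · congr 1
      ext w
      constructor
      · rintro (h | h)
        · exact ⟨h.1.1, h.2⟩
        · exact ⟨hBC h.1, h.2⟩
      · intro h
        by_cases hw : w ∈ B
        · exact Or.inr ⟨hw, h.2⟩
        · exact Or.inl ⟨⟨h.1, hw⟩, h.2⟩
    · rw [Set.disjoint_left]
      intro w h h'
      exact h.1.2 h'.1
  have hup := RelabelAux.upper_rho hk τ hτ hne n
  have hlo := RelabelAux.lower_rho hk n
  rw [← hB] at hup
  have c1 : ((2 * k - 1 : ℕ) : ℝ) = 2 * k - 1 := by
    rw [Nat.cast_sub (by omega)]; push_cast; ring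
  have c2 : ((2 * k - 2 : ℕ) : ℝ) = 2 * k - 2 := by
    rw [Nat.cast_sub (by omega)]; push_cast; ring
  have hup' : (rhoC B n : ℝ) ≤ (4 * k + 1) * (2 * k - 2) ^ (n + 1) := by
    rw [← c2]; exact_mod_cast hup
  have hlo' : ((2 * k - 1) ^ n : ℝ) ≤ rhoC (Cset k) n * (2 * k - 1) := by
    rw [← c1]; exact_mod_cast hlo
  have hsum' : (rhoC (Cset k \ B) n : ℝ) + rhoC B n = rhoC (Cset k) n := by exact_mod_cast hsum
  have hpn : (0 : ℝ) < (2 * k - 1) ^ n := by positivity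
  have hCpos : (0 : ℝ) < rhoC (Cset k) n := by
    by_contra hcon
    push Not at hcon
    nlinarith
  have e : 1 - (rhoC (Cset k \ B) n : ℝ) / rhoC (Cset k) n = rhoC B n / rhoC (Cset k) n := by
    field_simp
    linarith
  rw [e, abs_of_nonneg (by positivity), div_le_iff₀ hCpos, div_pow]
  refine hup'.trans ?_
  have : (4 * (k : ℝ) + 1) * (2 * k - 2) * (2 * k - 1) * ((2 * k - 2) ^ n / (2 * k - 1) ^ n) *
      rhoC (Cset k) n = (4 * k + 1) * (2 * k - 2) ^ (n + 1) *
      ((rhoC (Cset k) n * (2 * k - 1)) / (2 * k - 1) ^ n) := by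
    rw [pow_succ]; ring
  rw [this]
  apply le_mul_of_one_le_right (by positivity)
  rw [one_le_div hpn]
  exact hlo'
end
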